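/- arXiv:1705.09921 — 6 statements merged into one kernel-verified Lean document; each statement's English description precedes it below -/
import Mathlib

section
/- There exists a constant C > 0 such that for all h with 0 < h ≤ 1, sup_{λ ≥ 1} |A(λ + h) − A(λ)| ≤ (1/2) h log(1/h) + C h. -/
open MeasureTheory

/-- `A(λ) = ∫_0^∞ {t}{λt} t⁻² dt`. -/
noncomputable def Abm (lam : ℝ) : ℝ :=
  ∫ t in Set.Ioi (0 : ℝ), Int.fract t * Int.fract (lam * t) / t ^ 2

lemma intervalIntegrable_of_measurable_of_abs_le {f : ℝ → ℝ} (hf : Measurable f) {a b C : ℝ}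
    (hb : ∀ t ∈ Set.uIoc a b, |f t| ≤ C) : IntervalIntegrable f volume a b := by
  refine (intervalIntegrable_const (c := C)).mono_fun' hf.aestronglyMeasurable ?_
  filter_upwards [ae_restrict_mem measurableSet_uIoc] with t ht
  exact hb t ht

lemma measurable_fract_mul (m : ℝ) : Measurable fun t : ℝ => Int.fract (m * t) :=
  measurable_fract.comp (measurable_const_mul m)

/-- An interval integral of `w / t ^ 2` over `[a, b] ⊂ (0, ∞)` exists when `w` is bounded. -/
lemma intervalIntegrable_div_sq {w : ℝ → ℝ} (hw : Measurable w) {a b C : ℝ} (ha : 0 < a)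
    (hab : a ≤ b) (hC : ∀ t ∈ Set.Ioc a b, |w t| ≤ C) :
    IntervalIntegrable (fun t => w t / t ^ 2) volume a b := by
  refine intervalIntegrable_of_measurable_of_abs_le (C := C / a ^ 2) (by fun_prop) ?_
  intro t ht
  rw [Set.uIoc_of_le hab] at ht
  have h0 : 0 ≤ C := (abs_nonneg _).trans (hC t ht)
  rw [abs_div, abs_of_nonneg (sq_nonneg t)]
  have := hC t ht
  have := ht.1.le
  gcongr

lemma fract_le_self_of_nonneg {t : ℝ} (ht : 0 ≤ t) : Int.fract t ≤ t := by
  have : (0 : ℝ) ≤ ⌊t⌋ := by exact_mod_cast Int.floor_nonneg.2 ht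
  linarith [Int.self_sub_floor t]

lemma abs_fract_le_one (t : ℝ) : |Int.fract t| ≤ 1 := by
  rw [abs_of_nonneg (Int.fract_nonneg t)]
  exact (Int.fract_lt_one t).le

lemma abs_fract_sub_fract_le_one (s t : ℝ) : |Int.fract s - Int.fract t| ≤ 1 := by
  rw [abs_le]
  constructor <;>
    linarith [Int.fract_nonneg s, Int.fract_nonneg t, Int.fract_lt_one s, Int.fract_lt_one t]

lemma integral_one_div_sq {a b : ℝ} (ha : 0 < a) (hab : a ≤ b) :
    ∫ t in a..b, 1 / t ^ 2 = 1 / a - 1 / b := by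
  have h0 : (0 : ℝ) ∉ Set.uIcc a b := by
    rw [Set.uIcc_of_le hab]; exact fun h => absurd h.1 (by linarith)
  have := integral_zpow (a := a) (b := b) (n := -2) (Or.inr ⟨by norm_num, h0⟩)
  norm_num at this
  simp only [one_div]
  rw [this]
  ring

lemma integrableOn_Ioi_one_div_sq {X : ℝ} (hX : 0 < X) :
    IntegrableOn (fun t : ℝ => 1 / t ^ 2) (Set.Ioi X) := by
  refine (integrableOn_Ioi_rpow_of_lt (a := -2) (by norm_num) hX).congr_fun (fun t ht => ?_)
    measurableSet_Ioi
  have : (0 : ℝ) < t := hX.trans ht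
  simp only [one_div]
  rw [Real.rpow_neg this.le]; norm_cast

lemma integral_Ioi_one_div_sq {X : ℝ} (hX : 0 < X) :
    ∫ t in Set.Ioi X, 1 / t ^ 2 = 1 / X := by
  have := integral_Ioi_rpow_of_lt (a := -2) (by norm_num) hX
  norm_num [Real.rpow_neg_one] at this
  simpa only [one_div] using this

/-- `{t} {m t} / t²` is at most `m` on `(0, 1]`, and at most `1 / t²` throughout. -/
lemma integrableOn_fract_mul_fract (m : ℝ) (hm : 0 ≤ m) :
    IntegrableOn (fun t : ℝ => Int.fract t * Int.fract (m * t) / t ^ 2) (Set.Ioi 0) := by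
  have hmeas : Measurable fun t : ℝ => Int.fract t * Int.fract (m * t) / t ^ 2 :=
    (measurable_fract.mul (measurable_fract_mul m)).div (measurable_id.pow_const 2)
  rw [← Set.Ioc_union_Ioi_eq_Ioi (zero_le_one' ℝ)]
  refine IntegrableOn.union ?_ ?_
  · rw [← intervalIntegrable_iff_integrableOn_Ioc_of_le zero_le_one]
    refine intervalIntegrable_of_measurable_of_abs_le (C := m) hmeas ?_
    intro t ht
    rw [Set.uIoc_of_le zero_le_one] at ht
    have h1 := fract_le_self_of_nonneg ht.1.le
    have h2 := fract_le_self_of_nonneg (mul_nonneg hm ht.1.le)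
    have h3 := Int.fract_nonneg t
    have h4 := Int.fract_nonneg (m * t)
    have ht0 : 0 < t := ht.1
    rw [abs_of_nonneg (by positivity), div_le_iff₀ (by positivity)]
    nlinarith [mul_le_mul h1 h2 h4 ht0.le]
  · refine (integrableOn_Ioi_one_div_sq one_pos).mono' hmeas.aestronglyMeasurable ?_
    filter_upwards with t
    have h3 := Int.fract_nonneg t
    have h4 := Int.fract_nonneg (m * t)
    have h5 := (Int.fract_lt_one t).le
    have h6 := (Int.fract_lt_one (m * t)).le
    rw [Real.norm_of_nonneg (by positivity)]
    gcongr
    exact mul_le_one₀ h5 h4 h6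

lemma integral_fract_mul_fract_zero_one {m : ℝ} (hm : 0 < m) :
    ∫ t in (0 : ℝ)..1, Int.fract t * Int.fract (m * t) / t ^ 2 =
      ∫ u in (0 : ℝ)..m, Int.fract u / u := by
  have h := intervalIntegral.integral_comp_mul_left (a := 0) (b := 1)
    (fun u : ℝ => Int.fract u / u) hm.ne'
  rw [mul_zero, mul_one, smul_eq_mul, eq_comm, inv_mul_eq_iff_eq_mul₀ hm.ne',
    ← intervalIntegral.integral_const_mul] at h
  rw [h]
  refine intervalIntegral.integral_congr_Ioo_of_le zero_le_one fun t ht => ?_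
  have ht0 := ht.1.ne'
  simp only [Int.fract_eq_self.2 ⟨ht.1.le, ht.2⟩]
  field_simp

lemma abs_integral_fract_near_zero {lam h : ℝ} (hlam : 1 ≤ lam) (hh : 0 < h) :
    |(∫ t in (0 : ℝ)..1, Int.fract t * Int.fract ((lam + h) * t) / t ^ 2) -
      ∫ t in (0 : ℝ)..1, Int.fract t * Int.fract (lam * t) / t ^ 2| ≤ h := by
  rw [integral_fract_mul_fract_zero_one (by linarith),
    integral_fract_mul_fract_zero_one (by linarith)]
  have hb : ∀ t : ℝ, 0 < t → |Int.fract t / t| ≤ 1 := fun t ht => by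
    rw [abs_of_nonneg (div_nonneg (Int.fract_nonneg t) ht.le), div_le_one ht]
    exact fract_le_self_of_nonneg ht.le
  have hi : ∀ b : ℝ, 0 ≤ b → IntervalIntegrable (fun t : ℝ => Int.fract t / t) volume 0 b :=
    fun b hb0 => intervalIntegrable_of_measurable_of_abs_le (C := 1)
      (measurable_fract.div measurable_id) fun t ht => by
        rw [Set.uIoc_of_le hb0] at ht
        exact hb t ht.1
  rw [intervalIntegral.integral_interval_sub_left (hi _ (by linarith)) (hi _ (by linarith))]
  have := intervalIntegral.norm_integral_le_of_norm_le_const (a := lam) (b := lam + h) (C := 1)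
    (f := fun t : ℝ => Int.fract t / t) fun t ht => by
      rw [Set.uIoc_of_le (by linarith)] at ht
      exact hb t (by linarith [ht.1])
  rwa [add_sub_cancel_left, abs_of_pos hh, one_mul] at this

lemma abs_integral_fract_div_sq_le {a b : ℝ} (ha : 0 < a) (hab : a ≤ b) :
    |∫ u in a..b, Int.fract u / u ^ 2| ≤ 1 / a - 1 / b := by
  rw [← integral_one_div_sq ha hab, ← Real.norm_eq_abs]
  refine intervalIntegral.norm_integral_le_of_norm_le hab (.of_forall fun t _ => ?_)
    (intervalIntegrable_div_sq (w := fun _ => 1) measurable_const ha hab (C := 1) (by simp))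
  rw [Real.norm_eq_abs, abs_div, abs_of_nonneg (sq_nonneg t)]
  gcongr
  exact abs_fract_le_one t

lemma integral_fract_mul_div_sq {m X : ℝ} (hm : 0 < m) :
    ∫ t in (1 : ℝ)..X, Int.fract (m * t) / t ^ 2 =
      m * ∫ u in m..m * X, Int.fract u / u ^ 2 := by
  have h := intervalIntegral.integral_comp_mul_left (a := 1) (b := X)
    (fun u : ℝ => Int.fract u / u ^ 2) hm.ne'
  rw [mul_one, smul_eq_mul, eq_comm, inv_mul_eq_iff_eq_mul₀ hm.ne'] at h
  rw [h, ← mul_assoc, ← intervalIntegral.integral_const_mul]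
  refine intervalIntegral.integral_congr fun t _ => ?_
  by_cases ht : t = 0
  · simp [ht]
  · field_simp

/-- `μ ↦ ∫_1^X {μ t} t⁻² dt` is Lipschitz on `[1, ∞)`, uniformly in `X`. -/
lemma abs_integral_fract_sub_fract_div_sq_le {lam h X : ℝ} (hlam : 1 ≤ lam) (hh : 0 < h)
    (hX : 1 ≤ X) :
    |∫ t in (1 : ℝ)..X, (Int.fract ((lam + h) * t) - Int.fract (lam * t)) / t ^ 2| ≤ 3 * h := by
  have hl : 0 < lam := by linarith
  have hm : 0 < lam + h := by linarith
  have hX0 : 0 < X := by linarith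
  have hi : ∀ {a b : ℝ}, 0 < a → a ≤ b →
      IntervalIntegrable (fun u : ℝ => Int.fract u / u ^ 2) volume a b := fun ha hab =>
    intervalIntegrable_div_sq measurable_fract ha hab (C := 1) fun t _ => abs_fract_le_one t
  have hi' : ∀ m : ℝ, IntervalIntegrable (fun t : ℝ => Int.fract (m * t) / t ^ 2) volume 1 X :=
    fun m => intervalIntegrable_div_sq (measurable_fract_mul m) one_pos hX (C := 1)
      fun t _ => abs_fract_le_one _
  have h1 : lam ≤ lam * X := le_mul_of_one_le_right hl.le hX
  have h2 : lam + h ≤ (lam + h) * X := le_mul_of_one_le_right hm.le hX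
  have h3 : lam * X ≤ (lam + h) * X := by gcongr; linarith
  simp only [sub_div]
  rw [intervalIntegral.integral_sub (hi' _) (hi' _), integral_fract_mul_div_sq hm,
    integral_fract_mul_div_sq hl]
  have e1 := intervalIntegral.integral_add_adjacent_intervals (hi hl (by linarith : lam ≤ lam + h))
    (hi hm h2)
  have e2 := intervalIntegral.integral_add_adjacent_intervals (hi hl h1) (hi (by positivity) h3)
  have b1 := abs_integral_fract_div_sq_le hl (by linarith : lam ≤ lam + h)
  have b2 := abs_integral_fract_div_sq_le hm h2
  have b3 := abs_integral_fract_div_sq_le (by positivity) h3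
  set I1 := ∫ u in lam..lam + h, Int.fract u / u ^ 2
  set I2 := ∫ u in lam + h..(lam + h) * X, Int.fract u / u ^ 2
  set I3 := ∫ u in lam * X..(lam + h) * X, Int.fract u / u ^ 2
  set I4 := ∫ u in lam..lam * X, Int.fract u / u ^ 2
  have e3 : (lam + h) * I2 - lam * I4 = h * I2 + lam * I3 - lam * I1 := by
    have : I2 = I4 + I3 - I1 := by linarith
    rw [this]; ring
  have c1 : |lam * I1| ≤ h := by
    rw [abs_mul, abs_of_pos hl]
    calc lam * |I1| ≤ lam * (1 / lam - 1 / (lam + h)) := by gcongr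
      _ = h / (lam + h) := by field_simp; ring
      _ ≤ h := div_le_self hh.le (by linarith)
  have c2 : |h * I2| ≤ h := by
    rw [abs_mul, abs_of_pos hh]
    have : 1 / (lam + h) ≤ 1 := by rw [div_le_one hm]; linarith
    have : 0 < 1 / ((lam + h) * X) := by positivity
    nlinarith
  have c3 : |lam * I3| ≤ h := by
    rw [abs_mul, abs_of_pos hl]
    calc lam * |I3| ≤ lam * (1 / (lam * X) - 1 / ((lam + h) * X)) := by gcongr
      _ = h / ((lam + h) * X) := by field_simp; ring
      _ ≤ h := div_le_self hh.le (by nlinarith)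
  rw [e3]
  rw [abs_le] at *
  constructor <;> linarith [c1.1, c1.2, c2.1, c2.2, c3.1, c3.2]

lemma hasDerivWithinAt_fract_Ioi (x : ℝ) : HasDerivWithinAt Int.fract 1 (Set.Ioi x) x := by
  have h : HasDerivWithinAt (fun t : ℝ => t - ⌊x⌋) 1 (Set.Ioi x) x :=
    ((hasDerivAt_id x).sub_const _).hasDerivWithinAt
  refine h.congr_of_eventuallyEq ?_ rfl
  filter_upwards [Ioo_mem_nhdsGT (Int.lt_floor_add_one x)] with t ht
  rw [Int.fract, Int.floor_eq_iff.2 ⟨(Int.floor_le x).trans ht.1.le, ht.2⟩]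

lemma abs_fract_sub_half_le (t : ℝ) : |Int.fract t - 1 / 2| ≤ 1 / 2 := by
  rw [abs_le]
  constructor <;> linarith [Int.fract_nonneg t, Int.fract_lt_one t]

lemma intervalIntegrable_fract_sub_half_div {X : ℝ} (hX : 1 ≤ X) :
    IntervalIntegrable (fun t : ℝ => t * (Int.fract t - 1 / 2) / t ^ 2) volume 1 X := by
  refine intervalIntegrable_div_sq (w := fun t => t * (Int.fract t - 1 / 2))
    (measurable_id.mul (measurable_fract.sub_const _)) one_pos hX (C := X * (1 / 2))
    fun t ht => ?_
  rw [abs_mul]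
  refine mul_le_mul ?_ (abs_fract_sub_half_le t) (abs_nonneg _) (by linarith)
  rw [abs_of_pos (by linarith [ht.1])]
  exact ht.2

/-- `∫_1^X ({t} - 1/2) / t dt` is bounded. -/
lemma abs_integral_fract_sub_half_div_le {X : ℝ} (hX : 1 ≤ X) :
    |∫ t in (1 : ℝ)..X, t * (Int.fract t - 1 / 2) / t ^ 2| ≤ 1 := by
  set W : ℝ → ℝ := fun t => (Int.fract t ^ 2 - Int.fract t) / 2 with hW
  have hWm : Measurable W := ((measurable_fract.pow_const 2).sub measurable_fract).div_const 2
  have hWb : ∀ t, |W t| ≤ 1 / 2 := fun t => by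
    rw [abs_le]
    simp only [hW]
    constructor <;> nlinarith [Int.fract_nonneg t, Int.fract_lt_one t]
  have hWc : Continuous W :=
    ContinuousOn.comp_fract'' (f := fun u : ℝ => (u ^ 2 - u) / 2) (by fun_prop) (by norm_num)
  have i1 := intervalIntegrable_fract_sub_half_div hX
  have i2 : IntervalIntegrable (fun t : ℝ => W t / t ^ 2) volume 1 X :=
    intervalIntegrable_div_sq hWm one_pos hX fun t _ => hWb t
  have key := intervalIntegral.integral_eq_sub_of_hasDeriv_right (a := 1) (b := X)
    (f := fun t => W t / t)
    (f' := fun t => t * (Int.fract t - 1 / 2) / t ^ 2 - W t / t ^ 2)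
    (hWc.continuousOn.div continuousOn_id fun t ht => by
      rw [Set.uIcc_of_le hX] at ht
      exact (by linarith [ht.1] : (0 : ℝ) < t).ne')
    (fun t ht => by
      rw [min_eq_left hX] at ht
      have ht0 : t ≠ 0 := (by linarith [ht.1] : (0 : ℝ) < t).ne'
      have hf := hasDerivWithinAt_fract_Ioi t
      have hd := (((hf.pow 2).sub hf).div_const 2).div (hasDerivWithinAt_id t _) ht0
      refine (hd.congr_deriv ?_ :)
      simp only [hW, id, Pi.sub_apply, Pi.pow_apply]
      push_cast
      ring)
    (i1.sub i2)
  rw [intervalIntegral.integral_sub i1 i2] at key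
  have hb2 : |∫ t in (1 : ℝ)..X, W t / t ^ 2| ≤ 1 / 2 * (1 / 1 - 1 / X) := by
    rw [← integral_one_div_sq one_pos hX, ← intervalIntegral.integral_const_mul,
      ← Real.norm_eq_abs]
    refine intervalIntegral.norm_integral_le_of_norm_le hX (.of_forall fun t _ => ?_)
      ((intervalIntegrable_div_sq (w := fun _ => 1) measurable_const one_pos hX (C := 1)
        (by simp)).const_mul _)
    rw [Real.norm_eq_abs, abs_div, abs_of_nonneg (sq_nonneg t), mul_one_div]
    gcongr
    exact hWb t
  have hW1 : W 1 = 0 := by simp [hW]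
  have hWX : |W X / X| ≤ 1 / 2 := by
    rw [abs_div, abs_of_pos (by linarith : 0 < X)]
    exact (div_le_self (abs_nonneg _) hX).trans (hWb X)
  have hXp : 0 < 1 / X := by positivity
  simp only [hW1, zero_div, sub_zero] at key
  rw [abs_le] at *
  constructor <;> linarith [hb2.1, hb2.2, hWX.1, hWX.2]

lemma integral_mul_div_sq {X h : ℝ} (hX : 1 ≤ X) :
    ∫ t in (1 : ℝ)..X, h * t / t ^ 2 = h * Real.log X := by
  have := integral_one_div_of_pos one_pos (by linarith : 0 < X)
  rw [div_one] at this
  rw [← this, ← intervalIntegral.integral_const_mul]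
  refine intervalIntegral.integral_congr fun t ht => ?_
  rw [Set.uIcc_of_le hX] at ht
  have ht0 : t ≠ 0 := (by linarith [ht.1] : (0 : ℝ) < t).ne'
  field_simp

lemma abs_integral_fract_mul_sub_middle_le {lam h X : ℝ} (hlam : 1 ≤ lam) (hh : 0 < h)
    (hX : 1 ≤ X) :
    |∫ t in (1 : ℝ)..X,
        Int.fract t * (Int.fract ((lam + h) * t) - Int.fract (lam * t)) / t ^ 2| ≤
      1 / 2 * h * Real.log X + 4 * h := by
  set d : ℝ → ℝ := fun t => Int.fract ((lam + h) * t) - Int.fract (lam * t) with hd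
  have hJ : |∫ t in (1 : ℝ)..X, d t / t ^ 2| ≤ 3 * h :=
    abs_integral_fract_sub_fract_div_sq_le hlam hh hX
  have hS := abs_integral_fract_sub_half_div_le hX
  have hdm : Measurable d := (measurable_fract_mul _).sub (measurable_fract_mul _)
  have hdb : ∀ t, |d t| ≤ 1 := fun t => abs_fract_sub_fract_le_one _ _
  have hdle : ∀ t, 0 ≤ t → d t ≤ h * t := fun t ht => by
    have h1 : ⌊lam * t⌋ ≤ ⌊(lam + h) * t⌋ := Int.floor_le_floor (by nlinarith)
    have h2 : (⌊lam * t⌋ : ℝ) ≤ ⌊(lam + h) * t⌋ := by exact_mod_cast h1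
    simp only [hd, Int.fract]
    linarith
  have iJ : IntervalIntegrable (fun t => d t / t ^ 2) volume 1 X :=
    intervalIntegrable_div_sq hdm one_pos hX fun t _ => hdb t
  have iD : IntervalIntegrable (fun t => Int.fract t * d t / t ^ 2) volume 1 X :=
    intervalIntegrable_div_sq (w := fun t => Int.fract t * d t) (measurable_fract.mul hdm)
      one_pos hX (C := 1) fun t _ => by
      rw [abs_mul]; exact mul_le_one₀ (abs_fract_le_one t) (abs_nonneg _) (hdb t)
  have iS := intervalIntegrable_fract_sub_half_div hX
  have iL : IntervalIntegrable (fun t : ℝ => h * t / t ^ 2) volume 1 X :=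
    intervalIntegrable_div_sq (measurable_const_mul h) one_pos hX
      (C := h * X) fun t ht => by
        rw [abs_of_pos (mul_pos hh (by linarith [ht.1]))]
        exact mul_le_mul_of_nonneg_left ht.2 hh.le
  have hE : |∫ t in (1 : ℝ)..X, (Int.fract t * d t / t ^ 2 - 1 / 2 * (d t / t ^ 2) -
      h * (t * (Int.fract t - 1 / 2) / t ^ 2))| ≤
      ∫ t in (1 : ℝ)..X, (1 / 2 * (h * t / t ^ 2) - 1 / 2 * (d t / t ^ 2)) := by
    rw [← Real.norm_eq_abs]
    refine intervalIntegral.norm_integral_le_of_norm_le hX (.of_forall fun t ht => ?_)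
      ((iL.const_mul _).sub (iJ.const_mul _))
    have ht0 : 0 < t := by linarith [ht.1]
    have e : Int.fract t * d t / t ^ 2 - 1 / 2 * (d t / t ^ 2) -
      h * (t * (Int.fract t - 1 / 2) / t ^ 2) =
        (Int.fract t - 1 / 2) * (d t - h * t) / t ^ 2 := by ring
    have e' : 1 / 2 * (h * t / t ^ 2) - 1 / 2 * (d t / t ^ 2) =
        1 / 2 * (h * t - d t) / t ^ 2 := by ring
    rw [e, e', Real.norm_eq_abs, abs_div, abs_mul, abs_of_nonneg (sq_nonneg t),
      abs_of_nonpos (sub_nonpos.2 (hdle t ht0.le)), neg_sub]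
    have := sub_nonneg.2 (hdle t ht0.le)
    gcongr
    exact abs_fract_sub_half_le t
  rw [intervalIntegral.integral_sub (iD.sub (iJ.const_mul _)) (iS.const_mul _),
    intervalIntegral.integral_sub iD (iJ.const_mul _),
    intervalIntegral.integral_sub (iL.const_mul _) (iJ.const_mul _),
    intervalIntegral.integral_const_mul, intervalIntegral.integral_const_mul,
    intervalIntegral.integral_const_mul, integral_mul_div_sq hX] at hE
  set S := ∫ t in (1 : ℝ)..X, t * (Int.fract t - 1 / 2) / t ^ 2
  have hS' : |h * S| ≤ h := by
    rw [abs_mul, abs_of_pos hh]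
    exact mul_le_of_le_one_right hh.le hS
  rw [abs_le] at *
  constructor <;> linarith [hE.1, hE.2, hJ.1, hJ.2, hS'.1, hS'.2]

lemma abs_integral_Ioi_fract_mul_sub_le (l m : ℝ) {X : ℝ} (hX : 0 < X) :
    |∫ t in Set.Ioi X, Int.fract t * (Int.fract (m * t) - Int.fract (l * t)) / t ^ 2| ≤
      1 / X := by
  rw [← integral_Ioi_one_div_sq hX, ← Real.norm_eq_abs]
  refine norm_integral_le_of_norm_le (integrableOn_Ioi_one_div_sq hX) (.of_forall fun t => ?_)
  rw [Real.norm_eq_abs, abs_div, abs_mul, abs_of_nonneg (sq_nonneg t)]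
  gcongr
  exact mul_le_one₀ (abs_fract_le_one t) (abs_nonneg _) (abs_fract_sub_fract_le_one _ _)


/-- **Lemma 2.6** (Proposition 33 of Balazard–Martin). There is a constant `C > 0`
such that for all `h` with `0 < h ≤ 1`,
`sup_{λ ≥ 1} |A(λ+h) - A(λ)| ≤ (1/2) h log(1/h) + C h`. -/
theorem stmt_5 :
    ∃ C : ℝ, 0 < C ∧
      ∀ h : ℝ, 0 < h → h ≤ 1 →
        ∀ lam : ℝ, 1 ≤ lam →
          |Abm (lam + h) - Abm lam| ≤ 1 / 2 * h * Real.log (1 / h) + C * h := by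
  refine ⟨6, by norm_num, fun h hh h1 lam hlam => ?_⟩
  have hX : 1 ≤ 1 / h := by rwa [le_div_iff₀ hh, one_mul]
  have hl : 0 ≤ lam := by linarith
  have hm : 0 ≤ lam + h := by linarith
  have hq : ∀ t : ℝ, Int.fract t * Int.fract ((lam + h) * t) / t ^ 2 -
      Int.fract t * Int.fract (lam * t) / t ^ 2 =
        Int.fract t * (Int.fract ((lam + h) * t) - Int.fract (lam * t)) / t ^ 2 :=
    fun t => by ring
  have il := integrableOn_fract_mul_fract lam hl
  have im := integrableOn_fract_mul_fract (lam + h) hm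
  have split : Abm (lam + h) - Abm lam =
      ((∫ t in (0 : ℝ)..1, Int.fract t * Int.fract ((lam + h) * t) / t ^ 2) -
        ∫ t in (0 : ℝ)..1, Int.fract t * Int.fract (lam * t) / t ^ 2) +
      ((∫ t in (1 : ℝ)..1 / h,
        Int.fract t * (Int.fract ((lam + h) * t) - Int.fract (lam * t)) / t ^ 2) +
      ∫ t in Set.Ioi (1 / h),
        Int.fract t * (Int.fract ((lam + h) * t) - Int.fract (lam * t)) / t ^ 2) := by
    have iq : IntegrableOn (fun t : ℝ =>
        Int.fract t * (Int.fract ((lam + h) * t) - Int.fract (lam * t)) / t ^ 2) (Set.Ioi 0) := by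
      simp only [← hq]
      exact im.sub il
    have il1 := il.mono_set (Set.Ioi_subset_Ioi zero_le_one)
    have im1 := im.mono_set (Set.Ioi_subset_Ioi zero_le_one)
    rw [intervalIntegral.integral_interval_add_Ioi
      (iq.mono_set (Set.Ioi_subset_Ioi zero_le_one))
      (iq.mono_set (Set.Ioi_subset_Ioi (by linarith)))]
    simp only [← hq]
    rw [integral_sub im1 il1, Abm, Abm, ← intervalIntegral.integral_interval_add_Ioi il il1,
      ← intervalIntegral.integral_interval_add_Ioi im im1]
    ring
  have b1 := abs_integral_fract_near_zero hlam hh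
  have b2 := abs_integral_fract_mul_sub_middle_le hlam hh hX
  have b3 := abs_integral_Ioi_fract_mul_sub_le lam (lam + h) (X := 1 / h) (by linarith)
  rw [one_div_one_div] at b3
  rw [split]
  refine (abs_add_le _ _).trans ?_
  refine (add_le_add b1 ((abs_add_le _ _).trans (add_le_add b2 b3))).trans ?_
  linarith
end

section
/- Let x ∈ (0,1) be either an irrational Wilton number or a rational number of depth at least 1. Then 𝒲(x) = log(1/x) − x·𝒲(α(x)). -/
open Filter MeasureTheory

/-- The iterated Gauss map: `α₀(x) = x`, `α_l(x) = {1/α_{l-1}(x)}`. -/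
noncomputable def alphaIter : ℕ → ℝ → ℝ
  | 0, x => x
  | (l + 1), x => Int.fract (1 / alphaIter l x)

/-- `β_{l-1}(x) = α₀(x)α₁(x)⋯α_{l-1}(x)` (so `β_{-1} = 1`, the empty product). -/
noncomputable def betaProd (l : ℕ) (x : ℝ) : ℝ :=
  ∏ i ∈ Finset.range l, alphaIter i x

/-- `γ_l(x) = β_{l-1}(x) log(1/α_l(x))`. -/
noncomputable def gammaTerm (l : ℕ) (x : ℝ) : ℝ :=
  betaProd l x * Real.log (1 / alphaIter l x)

/-- Partial sums of the Wilton series `∑_{l≥0} (-1)^l γ_l(x)`. -/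
noncomputable def wiltonPartial (x : ℝ) (n : ℕ) : ℝ :=
  ∑ l ∈ Finset.range (n + 1), (-1 : ℝ) ^ l * gammaTerm l x

/-- The Wilton series converges at `x`. -/
def WiltonConverges (x : ℝ) : Prop :=
  ∃ W : ℝ, Tendsto (wiltonPartial x) atTop (nhds W)

/-- Wilton's function `𝒲(x)`, the sum of the Wilton series (junk value if
the series diverges; for rational `x` the terms eventually vanish so the series
is a finite sum). -/
noncomputable def wilton (x : ℝ) : ℝ := limUnder atTop (wiltonPartial x)

/-- The depth of a rational number `x ∈ (0,1)`: the largest `l` with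
`α_{l-1}(x) ≠ 0`, i.e. the least `l` with `α_l(x) = 0`. -/
noncomputable def depthCF (x : ℝ) : ℕ := sInf {l : ℕ | alphaIter l x = 0}

theorem alphaIter_succ_eq_alphaIter_one (l : ℕ) (x : ℝ) :
    alphaIter (l + 1) x = alphaIter l (alphaIter 1 x) := by
  induction l with
  | zero => rfl
  | succ l ih => exact congrArg (fun y => Int.fract (1 / y)) ih

theorem betaProd_succ_eq_mul (l : ℕ) (x : ℝ) :
    betaProd (l + 1) x = x * betaProd l (alphaIter 1 x) := by
  rw [betaProd, Finset.prod_range_succ', mul_comm, betaProd]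
  exact congrArg (x * ·) (Finset.prod_congr rfl fun i _ => alphaIter_succ_eq_alphaIter_one i x)

theorem gammaTerm_succ_eq_mul (l : ℕ) (x : ℝ) :
    gammaTerm (l + 1) x = x * gammaTerm l (alphaIter 1 x) := by
  rw [gammaTerm, gammaTerm, betaProd_succ_eq_mul, alphaIter_succ_eq_alphaIter_one l x, mul_assoc]

theorem wiltonPartial_succ_eq_sub (x : ℝ) (n : ℕ) :
    wiltonPartial x (n + 1) = Real.log (1 / x) - x * wiltonPartial (alphaIter 1 x) n := by
  have h_zero : gammaTerm 0 x = Real.log (1 / x) := by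
    simp [gammaTerm, betaProd, alphaIter]
  rw [wiltonPartial, Finset.sum_range_succ', h_zero, wiltonPartial, Finset.mul_sum,
    pow_zero, one_mul, add_comm, sub_eq_add_neg, ← Finset.sum_neg_distrib]
  congr 1
  refine Finset.sum_congr rfl fun l _ => ?_
  rw [gammaTerm_succ_eq_mul]
  ring

theorem gammaTerm_eq_zero_of_alphaIter_eq_zero {x : ℝ} {k l : ℕ}
    (hk : alphaIter k x = 0) (hkl : k ≤ l) : gammaTerm l x = 0 := by
  rcases hkl.eq_or_lt with rfl | hlt
  · simp [gammaTerm, hk]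
  · rw [gammaTerm, betaProd, Finset.prod_eq_zero (Finset.mem_range.2 hlt) hk, zero_mul]

theorem WiltonConverges.of_alphaIter_eq_zero {x : ℝ} {k : ℕ} (hk : alphaIter k x = 0) :
    WiltonConverges x := by
  refine ⟨wiltonPartial x k, tendsto_atTop_of_eventually_const (i₀ := k) fun n hn => ?_⟩
  refine (Finset.sum_subset (Finset.range_mono (Nat.succ_le_succ hn)) fun l _ hl => ?_).symm
  have hkl : k ≤ l := by
    rw [Finset.mem_range] at hl
    omega
  rw [gammaTerm_eq_zero_of_alphaIter_eq_zero hk hkl, mul_zero]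

theorem exists_alphaIter_eq_zero_of_depthCF_pos {x : ℝ} (h : 1 ≤ depthCF x) :
    ∃ k, alphaIter k x = 0 :=
  Nat.nonempty_of_pos_sInf h

theorem WiltonConverges.wilton_eq_sub {x : ℝ} (hx : x ≠ 0) (h : WiltonConverges x) :
    wilton x = Real.log (1 / x) - x * wilton (alphaIter 1 x) := by
  obtain ⟨W, hW⟩ := h
  have h_shift : Tendsto (wiltonPartial (alphaIter 1 x)) atTop
      (nhds ((Real.log (1 / x) - W) / x)) := by
    refine (((tendsto_const_nhds (x := Real.log (1 / x))).sub
      (hW.comp (tendsto_add_atTop_nat 1))).div_const x).congr fun n => ?_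
    rw [Function.comp_apply, wiltonPartial_succ_eq_sub]
    field_simp
    ring
  rw [wilton, wilton, hW.limUnder_eq, h_shift.limUnder_eq]
  field_simp
  ring

/-- **Lemma 2.9.** Let `x ∈ (0,1)` be either an irrational Wilton number or a
rational number of depth at least 1. Then `𝒲(x) = log(1/x) - x·𝒲(α(x))`. -/
theorem stmt_7 (x : ℝ) (hx0 : 0 < x) (hx1 : x < 1)
    (hx : (Irrational x ∧ WiltonConverges x) ∨ (¬ Irrational x ∧ 1 ≤ depthCF x)) :
    wilton x = Real.log (1 / x) - x * wilton (alphaIter 1 x) := by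
  have h_conv : WiltonConverges x := by
    rcases hx with ⟨-, h⟩ | ⟨-, h⟩
    · exact h
    · obtain ⟨k, hk⟩ := exists_alphaIter_eq_zero_of_depthCF_pos h
      exact .of_alphaIter_eq_zero hk
  exact h_conv.wilton_eq_sub hx0.ne'
end

section
/- Let p ≥ 1, let n ∈ ℕ, and let f : (0,1) → ℝ be measurable with ∫_0^1 |f(x)|^p dm(x) < ∞, where m is the Gauss measure. Then ∫_0^1 |T^n f(x)|^p dm(x) ≤ g^{(n−1)p} ∫_0^1 |f(x)|^p dm(x), where g = (√5 − 1)/2 < 1 and T^n denotes the n-fold iterate of T. -/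
open MeasureTheory

/-- The Gauss measure `m(E) = (1/log 2) ∫_E dx/(1+x)` on `(0,1)`. -/
noncomputable def gaussMeasure : Measure ℝ :=
  (volume.restrict (Set.Ioo (0 : ℝ) 1)).withDensity
    (fun x => ENNReal.ofReal ((Real.log 2)⁻¹ * (1 + x)⁻¹))

/-- The operator `T`: `(Tf)(x) = x·f({1/x})`. -/
noncomputable def Tgauss (f : ℝ → ℝ) : ℝ → ℝ :=
  fun x => x * f (Int.fract (1 / x))

/-- The Gauss map `α(x) = {1/x}`. -/
noncomputable def gaussMap (x : ℝ) : ℝ := Int.fract (1 / x)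

lemma measurable_gaussMap : Measurable gaussMap :=
  measurable_fract.comp (measurable_const.div measurable_id)

lemma Tgauss_iterate_succ_apply (f : ℝ → ℝ) (n : ℕ) (x : ℝ) :
    (Tgauss^[n + 1] f) x = x * (Tgauss^[n] f) (gaussMap x) := by
  rw [Function.iterate_succ_apply']; rfl

lemma mul_gaussMap_of_half_lt {x : ℝ} (hx : 1 / 2 < x) (hx1 : x ≤ 1) :
    x * gaussMap x = 1 - x := by
  have hpos : 0 < x := by linarith
  have hfloor : ⌊1 / x⌋ = 1 := by
    rw [Int.floor_eq_iff]
    constructor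
    · rw [le_div_iff₀ hpos]; simpa using hx1
    · rw [div_lt_iff₀ hpos]; push_cast; linarith
  rw [gaussMap, Int.fract, hfloor]
  push_cast
  field_simp

lemma abs_Tgauss_iterate_le (f : ℝ → ℝ) (n : ℕ) {x : ℝ} (hx0 : 0 ≤ x) (hx1 : x ≤ 1) :
    |(Tgauss^[n + 1] f) x| ≤ ((Real.sqrt 5 - 1) / 2) ^ n * |f (gaussMap^[n + 1] x)| := by
  have h5 : Real.sqrt 5 ^ 2 = 5 := Real.sq_sqrt (by norm_num)
  have hlow : 2 < Real.sqrt 5 := Real.lt_sqrt_of_sq_lt (by norm_num)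
  set g : ℝ := (Real.sqrt 5 - 1) / 2 with hg
  have hgsq : g ^ 2 = 1 - g := by rw [hg]; nlinarith
  have hghalf : 1 / 2 < g := by rw [hg]; linarith
  have hmap (y : ℝ) : 0 ≤ gaussMap y ∧ gaussMap y ≤ 1 :=
    ⟨Int.fract_nonneg _, (Int.fract_lt_one _).le⟩
  induction n using Nat.strong_induction_on generalizing x with
  | _ n ih =>
    rw [Tgauss_iterate_succ_apply, Function.iterate_succ_apply, abs_mul, abs_of_nonneg hx0]
    rcases n with _ | n
    · simpa using mul_le_of_le_one_left (abs_nonneg _) hx1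
    rcases le_or_gt x g with hxg | hxg
    · calc x * |(Tgauss^[n + 1] f) (gaussMap x)|
          ≤ g * (g ^ n * |f (gaussMap^[n + 1] (gaussMap x))|) := by
            gcongr
            exact ih n (by omega) (hmap x).1 (hmap x).2
        _ = _ := by ring
    · have hprod : x * gaussMap x ≤ g ^ 2 := by
        rw [mul_gaussMap_of_half_lt (by linarith) hx1]; linarith
      rw [Tgauss_iterate_succ_apply, Function.iterate_succ_apply, abs_mul,
        abs_of_nonneg (hmap x).1, ← mul_assoc]
      rcases n with _ | n
      · have : g ^ 2 ≤ g := by nlinarith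
        simp only [Function.iterate_zero, id_eq, zero_add, pow_one]
        gcongr
        linarith
      · calc x * gaussMap x * |(Tgauss^[n + 1] f) (gaussMap (gaussMap x))|
            ≤ g ^ 2 * (g ^ n * |f (gaussMap^[n + 1] (gaussMap (gaussMap x)))|) := by
              gcongr
              exact ih n (by omega) (hmap _).1 (hmap _).2
          _ = _ := by ring

/-- The inverse branches of the Gauss map. -/
noncomputable def gaussBranch (k : ℕ) (y : ℝ) : ℝ := (k + 1 + y)⁻¹

lemma gaussMap_gaussBranch (k : ℕ) {y : ℝ} (hy : y ∈ Set.Ico (0 : ℝ) 1) :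
    gaussMap (gaussBranch k y) = y := by
  have : (k : ℝ) + 1 + y = y + ((k + 1 : ℕ) : ℝ) := by push_cast; ring
  rw [gaussMap, gaussBranch, one_div, inv_inv, this, Int.fract_add_natCast,
    Int.fract_eq_self.2 hy]

lemma floor_inv_gaussBranch (k : ℕ) {y : ℝ} (hy : y ∈ Set.Ico (0 : ℝ) 1) :
    ⌊(gaussBranch k y)⁻¹⌋ = k + 1 := by
  rw [gaussBranch, inv_inv, Int.floor_eq_iff]
  push_cast
  exact ⟨by linarith [hy.1], by linarith [hy.2]⟩

lemma iUnion_gaussBranch_image :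
    ⋃ k : ℕ, gaussBranch k '' Set.Ico 0 1 = Set.Ioc (0 : ℝ) 1 := by
  ext x
  simp only [Set.mem_iUnion, Set.mem_image]
  constructor
  · rintro ⟨k, y, hy, rfl⟩
    have hk : (0 : ℝ) ≤ k := k.cast_nonneg
    have := hy.1
    exact ⟨inv_pos.2 (by linarith), inv_le_one_of_one_le₀ (by linarith)⟩
  · rintro ⟨h0, h1⟩
    have hfloor : 1 ≤ ⌊x⁻¹⌋ := by
      rw [Int.le_floor]; exact_mod_cast (one_le_inv₀ h0).2 h1
    obtain ⟨k, hk⟩ := Int.eq_ofNat_of_zero_le (sub_nonneg.2 hfloor)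
    refine ⟨k, Int.fract x⁻¹, ⟨Int.fract_nonneg _, Int.fract_lt_one _⟩, ?_⟩
    have hk' : (k : ℝ) + 1 = ⌊x⁻¹⌋ := by
      have : ⌊x⁻¹⌋ = (k : ℤ) + 1 := by omega
      rw [this]; push_cast; rfl
    rw [gaussBranch, hk', Int.floor_add_fract, inv_inv]

lemma injOn_gaussBranch (k : ℕ) : Set.InjOn (gaussBranch k) (Set.Ico 0 1) := by
  intro a ha b hb h
  rw [← gaussMap_gaussBranch k ha, h, gaussMap_gaussBranch k hb]

lemma hasDerivAt_gaussBranch (k : ℕ) {y : ℝ} (hy : 0 ≤ y) :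
    HasDerivAt (gaussBranch k) (-1 / ((k : ℝ) + 1 + y) ^ 2) y := by
  have hk : (0 : ℝ) ≤ k := k.cast_nonneg
  exact ((hasDerivAt_id' y).const_add ((k : ℝ) + 1)).inv (by positivity)

lemma measurableSet_gaussBranch_image (k : ℕ) :
    MeasurableSet (gaussBranch k '' Set.Ico 0 1) :=
  measurableSet_Ico.image_of_continuousOn_injOn
    (fun _ hy => (hasDerivAt_gaussBranch k hy.1).continuousAt.continuousWithinAt)
    (injOn_gaussBranch k)

lemma pairwise_disjoint_gaussBranch_image :
    Pairwise (Function.onFun Disjoint fun k : ℕ => gaussBranch k '' Set.Ico 0 1) := by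
  intro i j hij
  refine Set.disjoint_left.2 ?_
  rintro _ ⟨a, ha, rfl⟩ ⟨b, hb, hab⟩
  have h := floor_inv_gaussBranch i ha
  rw [← hab, floor_inv_gaussBranch j hb] at h
  omega

lemma hasSum_inv_mul_inv_succ {y : ℝ} (hy : 0 ≤ y) :
    HasSum (fun k : ℕ => ((k : ℝ) + 1 + y)⁻¹ * ((k : ℝ) + 1 + y + 1)⁻¹) (1 + y)⁻¹ := by
  rw [hasSum_iff_tendsto_nat_of_nonneg (fun k => by positivity)]
  have hsum (n : ℕ) : ∑ k ∈ Finset.range n, ((k : ℝ) + 1 + y)⁻¹ * ((k : ℝ) + 1 + y + 1)⁻¹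
      = (1 + y)⁻¹ - ((n : ℝ) + (1 + y))⁻¹ := by
    have h := Finset.sum_range_sub' (fun k : ℕ => ((k : ℝ) + 1 + y)⁻¹) n
    simp only [Nat.cast_zero, zero_add] at h
    rw [← add_assoc, ← h]
    refine Finset.sum_congr rfl fun k _ => ?_
    have h1 : (k : ℝ) + 1 + y ≠ 0 := by positivity
    have h2 : (k : ℝ) + 1 + 1 + y ≠ 0 := by positivity
    have h3 : (k : ℝ) + 1 + y + 1 ≠ 0 := by positivity
    push_cast
    field_simp
    ring
  simp_rw [hsum]
  have ht : Filter.Tendsto (fun n : ℕ => ((n : ℝ) + (1 + y))⁻¹) Filter.atTop (nhds 0) :=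
    tendsto_inv_atTop_zero.comp
      (Filter.tendsto_atTop_add_const_right _ _ tendsto_natCast_atTop_atTop)
  simpa using ht.const_sub (1 + y)⁻¹

lemma measurable_gaussDensity :
    Measurable fun x : ℝ => ENNReal.ofReal ((Real.log 2)⁻¹ * (1 + x)⁻¹) := by
  fun_prop

lemma lintegral_gaussMeasure {h : ℝ → ENNReal} (hh : Measurable h) :
    ∫⁻ x, h x ∂gaussMeasure =
      ∫⁻ x in Set.Ioo 0 1, ENNReal.ofReal ((Real.log 2)⁻¹ * (1 + x)⁻¹) * h x := by
  rw [gaussMeasure, lintegral_withDensity_eq_lintegral_mul _ measurable_gaussDensity hh]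
  rfl

/-- The transfer operator of the Gauss map fixes the Gauss density. -/
lemma tsum_gaussDensity_gaussBranch {y : ℝ} (hy : 0 ≤ y) :
    ∑' k : ℕ, ENNReal.ofReal |-1 / ((k : ℝ) + 1 + y) ^ 2| *
        ENNReal.ofReal ((Real.log 2)⁻¹ * (1 + gaussBranch k y)⁻¹) =
      ENNReal.ofReal ((Real.log 2)⁻¹ * (1 + y)⁻¹) := by
  have hlog : 0 < Real.log 2 := Real.log_pos (by norm_num)
  have hs := (hasSum_inv_mul_inv_succ hy).mul_left (Real.log 2)⁻¹
  rw [← hs.tsum_eq, ENNReal.ofReal_tsum_of_nonneg (fun k => by positivity) hs.summable]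
  refine tsum_congr fun k => ?_
  rw [← ENNReal.ofReal_mul (abs_nonneg _), abs_div, abs_neg, abs_one,
    abs_of_nonneg (by positivity), gaussBranch]
  congr 1
  have h1 : (k : ℝ) + 1 + y ≠ 0 := by positivity
  have h2 : (k : ℝ) + 1 + y + 1 ≠ 0 := by positivity
  have h3 : 1 + ((k : ℝ) + 1 + y)⁻¹ = (k + 1 + y + 1) / (k + 1 + y) := by field_simp
  rw [h3]
  field_simp

lemma lintegral_comp_gaussMap {h : ℝ → ENNReal} (hh : Measurable h) :
    ∫⁻ x, h (gaussMap x) ∂gaussMeasure = ∫⁻ x, h x ∂gaussMeasure := by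
  have hbranch (k : ℕ) : Measurable (gaussBranch k) := by
    unfold gaussBranch; fun_prop
  have hcomp : Measurable fun x => h (gaussMap x) := hh.comp measurable_gaussMap
  rw [lintegral_gaussMeasure hcomp, lintegral_gaussMeasure hh,
    setLIntegral_congr Ioo_ae_eq_Ioc, ← iUnion_gaussBranch_image,
    lintegral_iUnion measurableSet_gaussBranch_image pairwise_disjoint_gaussBranch_image,
    setLIntegral_congr Ioo_ae_eq_Ico]
  have himage (k : ℕ) :
      ∫⁻ x in gaussBranch k '' Set.Ico 0 1,
          ENNReal.ofReal ((Real.log 2)⁻¹ * (1 + x)⁻¹) * h (gaussMap x) =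
        ∫⁻ y in Set.Ico 0 1, ENNReal.ofReal |-1 / ((k : ℝ) + 1 + y) ^ 2| *
          ENNReal.ofReal ((Real.log 2)⁻¹ * (1 + gaussBranch k y)⁻¹) * h y := by
    rw [lintegral_image_eq_lintegral_abs_deriv_mul measurableSet_Ico
      (fun y hy => (hasDerivAt_gaussBranch k hy.1).hasDerivWithinAt) (injOn_gaussBranch k)]
    refine setLIntegral_congr_fun measurableSet_Ico fun y hy => ?_
    simp only [gaussMap_gaussBranch k hy, mul_assoc]
  simp_rw [himage]
  rw [← lintegral_tsum fun k => by fun_prop]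
  refine setLIntegral_congr_fun measurableSet_Ico fun y hy => ?_
  simp only [ENNReal.tsum_mul_right, tsum_gaussDensity_gaussBranch hy.1]

lemma measurePreserving_gaussMap : MeasurePreserving gaussMap gaussMeasure gaussMeasure := by
  refine ⟨measurable_gaussMap, Measure.ext fun s hs => ?_⟩
  rw [← lintegral_indicator_one hs, ← lintegral_indicator_one hs,
    lintegral_map (measurable_one.indicator hs) measurable_gaussMap]
  exact lintegral_comp_gaussMap (measurable_one.indicator hs)

lemma ae_gaussMeasure_mem_Ioo : ∀ᵐ x ∂gaussMeasure, x ∈ Set.Ioo (0 : ℝ) 1 :=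
  (withDensity_absolutelyContinuous _ _).ae_le (ae_restrict_mem measurableSet_Ioo)

/-- **Lemma 2.14** (Marmi–Moussa–Yoccoz). Let `p ≥ 1`, `n ∈ ℕ` with `n ≥ 1`, and let
`f : (0,1) → ℝ` be measurable with `∫_0^1 |f|^p dm < ∞`.  Then
`∫_0^1 |Tⁿf|^p dm ≤ g^{(n-1)p} ∫_0^1 |f|^p dm`, where `g = (√5-1)/2 < 1`. -/
theorem stmt_10 (p : ℝ) (hp : 1 ≤ p) (n : ℕ) (hn : 1 ≤ n) (f : ℝ → ℝ)
    (hf : Measurable f)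
    (hint : ∫⁻ x, ENNReal.ofReal (|f x| ^ p) ∂gaussMeasure < ⊤) :
    ∫⁻ x, ENNReal.ofReal (|(Tgauss^[n] f) x| ^ p) ∂gaussMeasure
      ≤ ENNReal.ofReal (((Real.sqrt 5 - 1) / 2) ^ (((n : ℝ) - 1) * p)) *
        ∫⁻ x, ENNReal.ofReal (|f x| ^ p) ∂gaussMeasure := by
  obtain ⟨n, rfl⟩ := Nat.exists_eq_add_of_le' hn
  have hg : 0 ≤ (Real.sqrt 5 - 1) / 2 := by
    have : 1 < Real.sqrt 5 := Real.lt_sqrt_of_sq_lt (by norm_num)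
    linarith
  have hmeas : Measurable fun x => ENNReal.ofReal (|f x| ^ p) := by fun_prop
  rw [← (measurePreserving_gaussMap.iterate (n + 1)).lintegral_comp hmeas,
    ← lintegral_const_mul' _ _ ENNReal.ofReal_ne_top]
  refine lintegral_mono_ae ?_
  filter_upwards [ae_gaussMeasure_mem_Ioo] with x hx
  rw [← ENNReal.ofReal_mul (by positivity)]
  refine ENNReal.ofReal_le_ofReal ?_
  have hexp : (((n + 1 : ℕ) : ℝ) - 1) * p = n * p := by push_cast; ring
  rw [hexp, Real.rpow_mul hg, Real.rpow_natCast,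
    ← Real.mul_rpow (by positivity) (abs_nonneg _)]
  exact Real.rpow_le_rpow (abs_nonneg _) (abs_Tgauss_iterate_le f n hx.1.le hx.2.le)
    (by linarith)
end

section
/- There is a constant C₁⁰ such that for every C₁ ≥ C₁⁰ there exist C₂ > 0 and s₀ ∈ ℕ with the property that for all integers s ≥ s₀, the Lebesgue measure of the set {x ∈ (0,1) : x irrational and q_s(x) ≥ exp(C₁ s)} is at most exp(−C₂ s). -/
open MeasureTheory

/-- The value of the finite continued fraction `[0; b₁, b₂, …]` given as a list. -/
noncomputable def contConv : List ℕ → ℝ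
  | [] => 0
  | b :: rest => 1 / (b + contConv rest)

/-- The list `[b₁, …, b_s]` from a (1-indexed) sequence of partial quotients. -/
def cfList (b : ℕ → ℕ) (s : ℕ) : List ℕ := (List.range s).map (fun i => b (i + 1))

/-- The list `[b₁, …, b_{s-1}, b_s + 1]`. -/
def cfListSucc (b : ℕ → ℕ) (s : ℕ) : List ℕ :=
  (List.range (s - 1)).map (fun i => b (i + 1)) ++ [b s + 1]

/-- The numerators `p_j` of `[0; b₁, …, b_j]`: `p₀ = 0`, `p₁ = 1`,
`p_{j+1} = b_{j+1} p_j + p_{j-1}` (so `p_{-1} = 1`). -/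
def cfP (b : ℕ → ℕ) : ℕ → ℕ
  | 0 => 0
  | 1 => 1
  | (j + 2) => b (j + 2) * cfP b (j + 1) + cfP b j

/-- The denominators `q_j` of `[0; b₁, …, b_j]`: `q₀ = 1`, `q₁ = b₁`,
`q_{j+1} = b_{j+1} q_j + q_{j-1}` (so `q_{-1} = 0`). -/
def cfQ (b : ℕ → ℕ) : ℕ → ℕ
  | 0 => 1
  | 1 => b 1
  | (j + 2) => b (j + 2) * cfQ b (j + 1) + cfQ b j

/-- The cell `𝒞(b₁, …, b_s)` of depth `s`: the interval with endpoints
`[0; b₁, …, b_s]` and `[0; b₁, …, b_{s-1}, b_s + 1]`. -/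
noncomputable def cellCF (b : ℕ → ℕ) (s : ℕ) : Set ℝ :=
  Set.uIcc (contConv (cfList b s)) (contConv (cfListSucc b s))

/-- The partial quotients `a_l(x) = ⌊1/α_{l-1}(x)⌋` of `x` (1-indexed). -/
noncomputable def aIter (l : ℕ) (x : ℝ) : ℕ := ⌊1 / alphaIter (l - 1) x⌋₊

lemma alphaIter_succ_eq_alphaIter_fract (l : ℕ) (x : ℝ) :
    alphaIter (l + 1) x = alphaIter l (Int.fract (1 / x)) := by
  induction l with
  | zero => rfl
  | succ l ih => rw [alphaIter, ih, ← alphaIter]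

lemma measurable_alphaIter (l : ℕ) : Measurable (alphaIter l) := by
  induction l with
  | zero => exact measurable_id
  | succ l ih => exact measurable_fract.comp (measurable_const.div ih)

lemma alphaIter_mem_Ioo_and_irrational {x : ℝ} (hx : x ∈ Set.Ioo (0 : ℝ) 1)
    (hirr : Irrational x) (l : ℕ) :
    alphaIter l x ∈ Set.Ioo (0 : ℝ) 1 ∧ Irrational (alphaIter l x) := by
  induction l with
  | zero => exact ⟨hx, hirr⟩
  | succ l ih =>
    have h : Irrational (alphaIter (l + 1) x) := by
      rw [alphaIter, one_div, Int.fract]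
      exact ih.2.inv.sub_intCast _
    exact ⟨⟨lt_of_le_of_ne (Int.fract_nonneg _) h.ne_zero.symm, Int.fract_lt_one _⟩, h⟩

lemma cfQ_le_prod (b : ℕ → ℕ) (s : ℕ) : cfQ b s ≤ ∏ i ∈ Finset.range s, (b (i + 1) + 1) := by
  induction s using Nat.strong_induction_on with
  | _ s ih =>
    match s with
    | 0 => simp [cfQ]
    | 1 => simp [cfQ]
    | j + 2 =>
      have h₁ := ih (j + 1) (by omega)
      have h₀ := ih j (by omega)
      have hmono : ∏ i ∈ Finset.range j, (b (i + 1) + 1) ≤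
          ∏ i ∈ Finset.range (j + 1), (b (i + 1) + 1) := by
        rw [Finset.prod_range_succ]
        exact Nat.le_mul_of_pos_right _ (Nat.succ_pos _)
      rw [Finset.prod_range_succ, cfQ]
      calc b (j + 2) * cfQ b (j + 1) + cfQ b j
          ≤ b (j + 2) * ∏ i ∈ Finset.range (j + 1), (b (i + 1) + 1) +
              ∏ i ∈ Finset.range (j + 1), (b (i + 1) + 1) :=
            add_le_add (Nat.mul_le_mul_left _ h₁) (h₀.trans hmono)
        _ = _ := by ring

lemma cfQ_aIter_le_prod {x : ℝ} (hx : x ∈ Set.Ioo (0 : ℝ) 1) (hirr : Irrational x) (s : ℕ) :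
    (cfQ (fun i => aIter i x) s : ℝ) ≤ ∏ i ∈ Finset.range s, 2 / alphaIter i x := by
  have h : (cfQ (fun i => aIter i x) s : ℝ) ≤
      ∏ i ∈ Finset.range s, ((aIter (i + 1) x : ℝ) + 1) := by
    exact_mod_cast cfQ_le_prod (fun i => aIter i x) s
  refine h.trans (Finset.prod_le_prod (fun i _ => by positivity) fun i _ => ?_)
  obtain ⟨⟨h0, h1⟩, -⟩ := alphaIter_mem_Ioo_and_irrational hx hirr i
  have hfloor : (aIter (i + 1) x : ℝ) ≤ 1 / alphaIter i x := Nat.floor_le (by positivity)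
  have hone : 1 ≤ 1 / alphaIter i x := (one_le_div h0).2 h1.le
  have htwo : 2 / alphaIter i x = 1 / alphaIter i x + 1 / alphaIter i x := by ring
  linarith

/-- Every point of `(0, 1)` lies in the image of `[0, 1)` under an inverse branch
`y ↦ 1 / (n + 1 + y)` of the Gauss map. -/
lemma Ioo_subset_iUnion_gauss_branch :
    Set.Ioo (0 : ℝ) 1 ⊆ ⋃ n : ℕ, (fun y : ℝ => (n + 1 + y)⁻¹) '' Set.Ico 0 1 := by
  intro x hx
  have hinv : 1 ≤ x⁻¹ := (one_le_inv₀ hx.1).2 hx.2.le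
  have hfloor : 1 ≤ ⌊x⁻¹⌋₊ := Nat.floor_pos.2 hinv
  obtain ⟨n, hn⟩ := Nat.exists_eq_add_of_le' hfloor
  have hle := Nat.floor_le (zero_le_one.trans hinv)
  have hlt := Nat.lt_floor_add_one x⁻¹
  rw [hn] at hle hlt
  push_cast at hle hlt
  refine Set.mem_iUnion.2 ⟨n, x⁻¹ - (n + 1), ⟨by linarith, by linarith⟩, ?_⟩
  simp

lemma lintegral_gauss_branch_image (n : ℕ) (f : ℝ → ENNReal) :
    ∫⁻ x in (fun y : ℝ => (n + 1 + y)⁻¹) '' Set.Ico 0 1, f x =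
      ∫⁻ y in Set.Ico (0 : ℝ) 1,
        ENNReal.ofReal (((n + 1 + y) ^ 2)⁻¹) * f ((n + 1 + y)⁻¹) := by
  have hderiv : ∀ y ∈ Set.Ico (0 : ℝ) 1, HasDerivWithinAt (fun y : ℝ => ((n : ℝ) + 1 + y)⁻¹)
      (-1 / ((n : ℝ) + 1 + y) ^ 2) (Set.Ico 0 1) y := by
    intro y hy
    have hpos : (0 : ℝ) < n + 1 + y := by have := hy.1; positivity
    exact (((hasDerivAt_id y).const_add ((n : ℝ) + 1)).fun_inv hpos.ne').hasDerivWithinAt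
  have hinj : Set.InjOn (fun y : ℝ => ((n : ℝ) + 1 + y)⁻¹) (Set.Ico 0 1) := by
    intro y _ z _ h
    simpa using h
  rw [lintegral_image_eq_lintegral_abs_deriv_mul measurableSet_Ico hderiv hinj]
  refine setLIntegral_congr_fun measurableSet_Ico fun y _ => ?_
  simp [neg_div, abs_neg, abs_inv]

/-- The integral of `√(2 / x) * g (fract (1 / x))` is controlled by that of `g`. -/
lemma lintegral_sqrt_mul_comp_gauss_le (g : ℝ → ENNReal) :
    ∫⁻ x in Set.Ioo (0 : ℝ) 1, ENNReal.ofReal √(2 / x) * g (Int.fract (1 / x)) ≤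
      (∑' n : ℕ, ENNReal.ofReal (√2 * ((n + 1 : ℕ) : ℝ) ^ (-(3 / 2) : ℝ))) *
        ∫⁻ x in Set.Ioo (0 : ℝ) 1, g x := by
  refine (lintegral_mono_set Ioo_subset_iUnion_gauss_branch).trans
    ((lintegral_iUnion_le _ _).trans ?_)
  rw [← ENNReal.tsum_mul_right]
  refine ENNReal.tsum_le_tsum fun n => ?_
  rw [lintegral_gauss_branch_image, ← lintegral_const_mul' _ _ ENNReal.ofReal_ne_top,
    setLIntegral_congr (Ioo_ae_eq_Ico (μ := volume) (a := (0 : ℝ)) (b := 1))]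
  refine setLIntegral_mono' measurableSet_Ico fun y hy => ?_
  have hn : (0 : ℝ) < n + 1 := by positivity
  have hpos : (0 : ℝ) < n + 1 + y := add_pos_of_pos_of_nonneg hn hy.1
  have hfract : Int.fract (1 / ((n : ℝ) + 1 + y)⁻¹) = y := by
    rw [one_div, inv_inv, Int.fract_eq_iff]
    exact ⟨hy.1, hy.2, n + 1, by push_cast; ring⟩
  rw [hfract, ← mul_assoc, ← ENNReal.ofReal_mul (by positivity)]
  refine mul_le_mul_left (ENNReal.ofReal_le_ofReal ?_) _
  rw [div_inv_eq_mul, Real.sqrt_mul (by norm_num)]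
  have hrpow : (((n : ℝ) + 1 + y) ^ 2)⁻¹ * √((n : ℝ) + 1 + y) =
      ((n : ℝ) + 1 + y) ^ (-(3 / 2) : ℝ) := by
    rw [Real.sqrt_eq_rpow, ← Real.rpow_natCast, ← Real.rpow_neg hpos.le, ← Real.rpow_add hpos]
    norm_num
  calc (((n : ℝ) + 1 + y) ^ 2)⁻¹ * (√2 * √((n : ℝ) + 1 + y))
      = √2 * ((n : ℝ) + 1 + y) ^ (-(3 / 2) : ℝ) := by rw [← hrpow]; ring
    _ ≤ √2 * ((n + 1 : ℕ) : ℝ) ^ (-(3 / 2) : ℝ) := by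
      push_cast
      exact mul_le_mul_of_nonneg_left
        (Real.rpow_le_rpow_of_nonpos hn (by linarith [hy.1]) (by norm_num)) (Real.sqrt_nonneg _)

lemma tsum_sqrt_two_mul_rpow_ne_top :
    ∑' n : ℕ, ENNReal.ofReal (√2 * ((n + 1 : ℕ) : ℝ) ^ (-(3 / 2) : ℝ)) ≠ ⊤ := by
  have h : Summable fun n : ℕ => (n : ℝ) ^ (-(3 / 2) : ℝ) :=
    Real.summable_nat_rpow.2 (by norm_num)
  exact (((summable_nat_add_iff 1).2 h).mul_left √2).tsum_ofReal_ne_top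

lemma lintegral_prod_sqrt_alphaIter_le (s : ℕ) :
    ∫⁻ x in Set.Ioo (0 : ℝ) 1, ∏ i ∈ Finset.range s, ENNReal.ofReal √(2 / alphaIter i x) ≤
      (∑' n : ℕ, ENNReal.ofReal (√2 * ((n + 1 : ℕ) : ℝ) ^ (-(3 / 2) : ℝ))) ^ s := by
  induction s with
  | zero => simp
  | succ s ih =>
    simp_rw [Finset.prod_range_succ', alphaIter_succ_eq_alphaIter_fract]
    simp_rw [mul_comm _ (ENNReal.ofReal √(2 / alphaIter 0 _))]
    rw [pow_succ']
    exact (lintegral_sqrt_mul_comp_gauss_le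
      fun x => ∏ i ∈ Finset.range s, ENNReal.ofReal √(2 / alphaIter i x)).trans (by gcongr)

/-- **Lemma 2.19.** There is a constant `C₁⁰` such that for every `C₁ ≥ C₁⁰` there
exist `C₂ > 0` and `s₀ ∈ ℕ` with the property that for all integers `s ≥ s₀`, the
Lebesgue measure of `{x ∈ (0,1) : x irrational, q_s(x) ≥ exp(C₁ s)}` is at most
`exp(-C₂ s)`. -/
theorem stmt_15 :
    ∃ C₁0 : ℝ, ∀ C₁ : ℝ, C₁0 ≤ C₁ →
      ∃ C₂ : ℝ, 0 < C₂ ∧ ∃ s₀ : ℕ, ∀ s : ℕ, s₀ ≤ s →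
        volume {x ∈ Set.Ioo (0 : ℝ) 1 | Irrational x ∧
            Real.exp (C₁ * s) ≤ (cfQ (fun i => aIter i x) s : ℝ)}
          ≤ ENNReal.ofReal (Real.exp (-C₂ * s)) := by
  set K := ∑' n : ℕ, ENNReal.ofReal (√2 * ((n + 1 : ℕ) : ℝ) ^ (-(3 / 2) : ℝ)) with hK
  have hKtop : K ≠ ⊤ := tsum_sqrt_two_mul_rpow_ne_top
  refine ⟨2 * (K.toReal + 1), fun C₁ hC₁ => ⟨1, one_pos, 0, fun s _ => ?_⟩⟩
  have hmeas : Measurable fun x : ℝ =>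
      ∏ i ∈ Finset.range s, ENNReal.ofReal √(2 / alphaIter i x) :=
    Finset.measurable_fun_prod _ fun i _ =>
      (measurable_const.div (measurable_alphaIter i)).sqrt.ennreal_ofReal
  set c := ENNReal.ofReal (Real.exp (C₁ * s / 2)) with hc
  have hsub : {x ∈ Set.Ioo (0 : ℝ) 1 | Irrational x ∧
      Real.exp (C₁ * s) ≤ (cfQ (fun i => aIter i x) s : ℝ)} ⊆
      {x | c ≤ ∏ i ∈ Finset.range s, ENNReal.ofReal √(2 / alphaIter i x)} ∩
        Set.Ioo (0 : ℝ) 1 := by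
    rintro x ⟨hx, hirr, hq⟩
    refine ⟨?_, hx⟩
    rw [Set.mem_ofPred_eq, ← ENNReal.ofReal_prod_of_nonneg fun i _ => Real.sqrt_nonneg _]
    refine ENNReal.ofReal_le_ofReal ?_
    rw [Real.exp_half, ← Real.sqrt_prod]
    · exact Real.sqrt_le_sqrt (hq.trans (cfQ_aIter_le_prod hx hirr s))
    · exact fun i _ => div_nonneg zero_le_two (alphaIter_mem_Ioo_and_irrational hx hirr i).1.1.le
  have hc0 : c ≠ 0 := by simpa [hc] using Real.exp_pos _
  have hmarkov := meas_ge_le_lintegral_div (μ := volume.restrict (Set.Ioo (0 : ℝ) 1))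
    hmeas.aemeasurable hc0 ENNReal.ofReal_ne_top
  rw [Measure.restrict_apply (measurableSet_le measurable_const hmeas)] at hmarkov
  refine (measure_mono hsub).trans (hmarkov.trans ?_)
  refine (ENNReal.div_le_div_right (lintegral_prod_sqrt_alphaIter_le s) c).trans ?_
  rw [ENNReal.div_le_iff hc0 ENNReal.ofReal_ne_top, ← hK, hc,
    ← ENNReal.ofReal_mul (Real.exp_pos _).le, ← Real.exp_add,
    ← ENNReal.ofReal_toReal hKtop,
    ← ENNReal.ofReal_pow ENNReal.toReal_nonneg]
  refine ENNReal.ofReal_le_ofReal ?_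
  have hexp : K.toReal ≤ Real.exp K.toReal := by linarith [Real.add_one_le_exp K.toReal]
  refine (pow_le_pow_left₀ ENNReal.toReal_nonneg hexp s).trans ?_
  rw [← Real.exp_nat_mul]
  refine Real.exp_le_exp.2 ?_
  have hs : (0 : ℝ) ≤ s := s.cast_nonneg
  nlinarith
end

section
/- Let w > 1. For every positive integer h one has μ(h) = c₁(h) + c₂(h) + c₃(h), where c₁(h) := Σ_{αβγ = h, α ≥ w, β ≥ w} μ(γ) c₄(α) c₄(β) with c₄(α) := −Σ_{d₁d₂ = α, d₁ ≤ w} μ(d₁); c₂(h) := 2μ(h) if h ≤ w and c₂(h) := 0 if h > w; and c₃(h) := −Σ_{αβγ = h, α ≤ w, β ≤ w} μ(α)μ(β). -/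
open ArithmeticFunction

/-- `c₄(α) = -∑_{d₁d₂ = α, d₁ ≤ w} μ(d₁)`. -/
noncomputable def c4V (w : ℝ) (a : ℕ) : ℤ :=
  -∑ d ∈ a.divisorsAntidiagonal, if (d.1 : ℝ) ≤ w then moebius d.1 else 0

/-- `c₁(h) = ∑_{αβγ = h, α ≥ w, β ≥ w} μ(γ) c₄(α) c₄(β)`, the sum being over
ordered triples `(α, β, γ)` of positive integers with `αβγ = h`. -/
noncomputable def c1V (w : ℝ) (h : ℕ) : ℤ :=
  ∑ p ∈ h.divisorsAntidiagonal, ∑ q ∈ p.2.divisorsAntidiagonal,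
    if w ≤ (p.1 : ℝ) ∧ w ≤ (q.1 : ℝ) then moebius q.2 * c4V w p.1 * c4V w q.1 else 0

/-- `c₂(h) = 2μ(h)` if `h ≤ w`, and `0` if `h > w`. -/
noncomputable def c2V (w : ℝ) (h : ℕ) : ℤ :=
  if (h : ℝ) ≤ w then 2 * moebius h else 0

/-- `c₃(h) = -∑_{αβγ = h, α ≤ w, β ≤ w} μ(α)μ(β)`, the sum being over ordered
triples `(α, β, γ)` of positive integers with `αβγ = h`. -/
noncomputable def c3V (w : ℝ) (h : ℕ) : ℤ :=
  -∑ p ∈ h.divisorsAntidiagonal, ∑ q ∈ p.2.divisorsAntidiagonal,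
    if (p.1 : ℝ) ≤ w ∧ (q.1 : ℝ) ≤ w then moebius p.1 * moebius q.1 else 0

/-- The Möbius function truncated to arguments `≤ w`. -/
noncomputable def moebiusTrunc (w : ℝ) : ArithmeticFunction ℤ :=
  ⟨fun n => if (n : ℝ) ≤ w then moebius n else 0, by simp⟩

theorem moebiusTrunc_apply (w : ℝ) (n : ℕ) :
    moebiusTrunc w n = if (n : ℝ) ≤ w then moebius n else 0 := rfl

theorem c4V_eq_neg_moebiusTrunc_mul_zeta (w : ℝ) (a : ℕ) :
    c4V w a = -(moebiusTrunc w * (zeta : ArithmeticFunction ℤ)) a := by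
  rw [c4V, mul_apply]
  congr 1
  refine Finset.sum_congr rfl fun d hd => ?_
  have hd2 : d.2 ≠ 0 := Nat.ne_zero_of_mem_divisorsAntidiagonal hd |>.2
  simp [moebiusTrunc_apply, natCoe_apply, zeta_apply, hd2]

theorem moebiusTrunc_mul_zeta_of_le {w : ℝ} {a : ℕ} (ha : (a : ℝ) ≤ w) :
    (moebiusTrunc w * (zeta : ArithmeticFunction ℤ)) a = (1 : ArithmeticFunction ℤ) a := by
  rw [← moebius_mul_coe_zeta, mul_apply, mul_apply]
  refine Finset.sum_congr rfl fun d hd => ?_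
  have hda : d.1 ≤ a := Nat.divisor_le (Nat.fst_mem_divisors_of_mem_antidiagonal hd)
  have hdw : (d.1 : ℝ) ≤ w := le_trans (by exact_mod_cast hda) ha
  rw [moebiusTrunc_apply, if_pos hdw]

theorem one_sub_moebiusTrunc_mul_zeta_apply {w : ℝ} (hw : 1 < w) (a : ℕ) :
    (1 - moebiusTrunc w * (zeta : ArithmeticFunction ℤ)) a =
      if w ≤ (a : ℝ) then c4V w a else 0 := by
  rw [sub_eq_add_neg, ArithmeticFunction.add_apply, ArithmeticFunction.neg_apply]
  split_ifs with hwa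
  · have ha : a ≠ 1 := by
      rintro rfl
      norm_num at hwa
      linarith
    rw [one_apply_ne ha, c4V_eq_neg_moebiusTrunc_mul_zeta, zero_add]
  · rw [moebiusTrunc_mul_zeta_of_le (not_le.mp hwa).le, add_neg_cancel]

theorem c1V_eq_mul {w : ℝ} (hw : 1 < w) (h : ℕ) :
    c1V w h = ((1 - moebiusTrunc w * (zeta : ArithmeticFunction ℤ)) *
      ((1 - moebiusTrunc w * (zeta : ArithmeticFunction ℤ)) * moebius)) h := by
  rw [c1V, mul_apply]
  refine Finset.sum_congr rfl fun p _ => ?_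
  rw [mul_apply, Finset.mul_sum]
  refine Finset.sum_congr rfl fun q _ => ?_
  rw [one_sub_moebiusTrunc_mul_zeta_apply hw, one_sub_moebiusTrunc_mul_zeta_apply hw, ite_and]
  split_ifs <;> ring

theorem c2V_eq_two_mul (w : ℝ) (h : ℕ) : c2V w h = 2 * moebiusTrunc w h := by
  simp [c2V, moebiusTrunc_apply]

theorem c3V_eq_neg_mul (w : ℝ) (h : ℕ) :
    c3V w h = -(moebiusTrunc w * (moebiusTrunc w * (zeta : ArithmeticFunction ℤ))) h := by
  rw [c3V, mul_apply]
  congr 1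
  refine Finset.sum_congr rfl fun p _ => ?_
  rw [mul_apply, Finset.mul_sum]
  refine Finset.sum_congr rfl fun q hq => ?_
  have hq2 : q.2 ≠ 0 := Nat.ne_zero_of_mem_divisorsAntidiagonal hq |>.2
  by_cases hp : (p.1 : ℝ) ≤ w <;> simp [moebiusTrunc_apply, natCoe_apply, zeta_apply, hq2, hp]

/-- **Lemma 3.1** (Vaughan's identity). Let `w > 1`. For every positive integer `h`
one has `μ(h) = c₁(h) + c₂(h) + c₃(h)`. -/
theorem stmt_16 (w : ℝ) (hw : 1 < w) (h : ℕ) (hh : 0 < h) :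
    (moebius h : ℤ) = c1V w h + c2V w h + c3V w h := by
  have key : (moebius : ArithmeticFunction ℤ) =
      (1 - moebiusTrunc w * (zeta : ArithmeticFunction ℤ)) *
        ((1 - moebiusTrunc w * (zeta : ArithmeticFunction ℤ)) * moebius) +
      (moebiusTrunc w + moebiusTrunc w) +
      -(moebiusTrunc w * (moebiusTrunc w * (zeta : ArithmeticFunction ℤ))) := by
    linear_combination
      (2 * moebiusTrunc w - moebiusTrunc w * moebiusTrunc w * (zeta : ArithmeticFunction ℤ)) *
        moebius_mul_coe_zeta
  rw [c1V_eq_mul hw, c2V_eq_two_mul, c3V_eq_neg_mul, two_mul]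
  exact DFunLike.congr_fun key h
end

section
/- Let x ∈ (0,1) be irrational with continued fraction convergents u_n/v_n (in lowest terms). Then the series Σ_{n=1}^∞ d(n) sin(2πnx)/n converges (as a limit of partial sums) if and only if the series Σ_{n≥1} (−1)^n (log v_{n+1})/v_n converges; irrational numbers for which this holds are called Wilton numbers. -/
open Filter

/-- The denominators `v_n(x)` of the convergents `u_n/v_n = [0; a₁(x), …, a_n(x)]`
(in lowest terms): `v₀ = 1`, `v₁ = a₁(x)`, `v_{n+1} = a_{n+1}(x) v_n + v_{n-1}`. -/
noncomputable def convDen (x : ℝ) : ℕ → ℕ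
  | 0 => 1
  | 1 => aIter 1 x
  | (n + 2) => aIter (n + 2) x * convDen x (n + 1) + convDen x n

/-- The block `∑_{A < l ≤ B} sin (2πly) / l` of the sawtooth Fourier series. -/
noncomputable def sawSum (A B : ℕ) (y : ℝ) : ℝ :=
  ∑ l ∈ Finset.Ioc A B, Real.sin (2 * Real.pi * l * y) / l

lemma two_mul_sin_mul_sum_Ioc_sin (A B : ℕ) (h : A ≤ B) (y : ℝ) :
    2 * Real.sin (Real.pi * y) * ∑ l ∈ Finset.Ioc A B, Real.sin (2 * Real.pi * l * y) =
      Real.cos ((2 * A + 1) * (Real.pi * y)) - Real.cos ((2 * B + 1) * (Real.pi * y)) := by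
  induction B, h using Nat.le_induction with
  | base => simp
  | succ B h ih =>
    rw [Finset.sum_Ioc_succ_top (by omega), mul_add, ih]
    have h1 := Real.cos_sub (2 * Real.pi * ((B + 1 : ℕ) : ℝ) * y) (Real.pi * y)
    have h2 := Real.cos_add (2 * Real.pi * ((B + 1 : ℕ) : ℝ) * y) (Real.pi * y)
    have e1 : (2 * (B : ℝ) + 1) * (Real.pi * y)
        = 2 * Real.pi * ((B + 1 : ℕ) : ℝ) * y - Real.pi * y := by push_cast; ring
    have e2 : (2 * ((B + 1 : ℕ) : ℝ) + 1) * (Real.pi * y)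
        = 2 * Real.pi * ((B + 1 : ℕ) : ℝ) * y + Real.pi * y := by push_cast; ring
    rw [e1, e2, h1, h2]
    ring

lemma abs_sum_Ioc_sin_le (A B : ℕ) {y : ℝ} (hy : Real.sin (Real.pi * y) ≠ 0) :
    |∑ l ∈ Finset.Ioc A B, Real.sin (2 * Real.pi * l * y)| ≤ 1 / |Real.sin (Real.pi * y)| := by
  have hpos : 0 < |Real.sin (Real.pi * y)| := abs_pos.mpr hy
  rcases le_total A B with h | h
  · have key := congrArg abs (two_mul_sin_mul_sum_Ioc_sin A B h y)
    rw [abs_mul, abs_mul, abs_two] at key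
    have h1 := abs_sub (Real.cos ((2 * A + 1) * (Real.pi * y)))
      (Real.cos ((2 * B + 1) * (Real.pi * y)))
    have h2 := Real.abs_cos_le_one ((2 * A + 1) * (Real.pi * y))
    have h3 := Real.abs_cos_le_one ((2 * B + 1) * (Real.pi * y))
    rw [le_div_iff₀ hpos]
    linarith
  · rw [Finset.Ioc_eq_empty_of_le h]
    simp

/-- Abel summation against the weight `1 / l`. -/
lemma abs_sum_Ioc_div_le {f : ℕ → ℝ} {A : ℕ} {M : ℝ}
    (hf : ∀ B, |∑ l ∈ Finset.Ioc A B, f l| ≤ M) (B : ℕ) :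
    |∑ l ∈ Finset.Ioc A B, f l / l| ≤ M / (A + 1) := by
  have hM : 0 ≤ M := (abs_nonneg _).trans (hf A)
  rcases le_total A B with h | h
  · have key : |∑ l ∈ Finset.Ioc A B, f l / l - (∑ l ∈ Finset.Ioc A B, f l) / (B + 1)|
        ≤ M * (1 / (A + 1) - 1 / (B + 1)) := by
      induction B, h using Nat.le_induction with
      | base => simp
      | succ B h ih =>
        have hs (g : ℕ → ℝ) := Finset.sum_Ioc_succ_top (a := A) (b := B) (by omega) g
        have hB : (0 : ℝ) < B + 1 := by positivity
        have e : ∑ l ∈ Finset.Ioc A (B + 1), f l / l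
              - (∑ l ∈ Finset.Ioc A (B + 1), f l) / ((B + 1 : ℕ) + 1)
            = (∑ l ∈ Finset.Ioc A B, f l / l - (∑ l ∈ Finset.Ioc A B, f l) / (B + 1))
              + (∑ l ∈ Finset.Ioc A (B + 1), f l) * (1 / (B + 1) - 1 / ((B + 1 : ℕ) + 1)) := by
          rw [hs, hs]
          push_cast
          field_simp
          ring
        have hd : (0 : ℝ) ≤ 1 / (B + 1) - 1 / ((B + 1 : ℕ) + 1) := by
          rw [sub_nonneg]
          apply one_div_le_one_div_of_le hB
          push_cast
          linarith
        rw [e]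
        refine (abs_add_le _ _).trans ?_
        rw [abs_mul, abs_of_nonneg hd]
        have := mul_le_mul_of_nonneg_right (hf (B + 1)) hd
        linarith
    have h2 : |(∑ l ∈ Finset.Ioc A B, f l) / ((B : ℝ) + 1)| ≤ M / (B + 1) := by
      rw [abs_div, abs_of_pos (by positivity : (0 : ℝ) < B + 1)]
      gcongr
      exact hf B
    have h3 := abs_add_le (∑ l ∈ Finset.Ioc A B, f l / l - (∑ l ∈ Finset.Ioc A B, f l) / (B + 1))
      ((∑ l ∈ Finset.Ioc A B, f l) / (B + 1))
    rw [sub_add_cancel] at h3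
    have : M * (1 / ((A : ℝ) + 1) - 1 / (B + 1)) + M / (B + 1) = M / (A + 1) := by ring
    linarith
  · rw [Finset.Ioc_eq_empty_of_le h]
    simp
    positivity

lemma abs_sawSum_le_div (A B : ℕ) {y : ℝ} (hy : Real.sin (Real.pi * y) ≠ 0) :
    |sawSum A B y| ≤ 1 / ((A + 1) * |Real.sin (Real.pi * y)|) := by
  have := abs_sum_Ioc_div_le (f := fun l => Real.sin (2 * Real.pi * l * y))
    (fun B => abs_sum_Ioc_sin_le A B hy) B
  rwa [div_div, mul_comm |Real.sin (Real.pi * y)|] at this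

lemma abs_sin_nat_mul_le (n : ℕ) (t : ℝ) : |Real.sin (n * t)| ≤ n * |Real.sin t| := by
  induction n with
  | zero => simp
  | succ n ih =>
    have e : ((n + 1 : ℕ) : ℝ) * t = n * t + t := by push_cast; ring
    rw [e, Real.sin_add]
    refine (abs_add_le _ _).trans ?_
    rw [abs_mul, abs_mul]
    have h1 := mul_le_of_le_one_right (abs_nonneg (Real.sin (n * t))) (Real.abs_cos_le_one t)
    have h2 := mul_le_of_le_one_left (abs_nonneg (Real.sin t)) (Real.abs_cos_le_one (n * t))
    push_cast
    linarith

lemma abs_sin_two_pi_mul_le (l : ℕ) (y : ℝ) :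
    |Real.sin (2 * Real.pi * l * y)| ≤ 2 * l * |Real.sin (Real.pi * y)| := by
  have h := abs_sin_nat_mul_le (l * 2) (Real.pi * y)
  push_cast at h
  rw [show 2 * Real.pi * (l : ℝ) * y = (l : ℝ) * 2 * (Real.pi * y) by ring]
  linarith

lemma abs_sawSum_le_mul (A B : ℕ) (y : ℝ) :
    |sawSum A B y| ≤ 2 * B * |Real.sin (Real.pi * y)| := by
  have : ∀ l ∈ Finset.Ioc A B, |Real.sin (2 * Real.pi * l * y) / l|
      ≤ 2 * |Real.sin (Real.pi * y)| := by
    intro l hl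
    have hl : (0 : ℝ) < l := by
      have := (Finset.mem_Ioc.mp hl).1
      exact_mod_cast (by omega : 0 < l)
    rw [abs_div, abs_of_pos hl, div_le_iff₀ hl]
    linarith [abs_sin_two_pi_mul_le l y]
  refine (Finset.abs_sum_le_sum_abs _ _).trans ((Finset.sum_le_card_nsmul _ _ _ this).trans ?_)
  rw [nsmul_eq_mul, Nat.card_Ioc]
  have : ((B - A : ℕ) : ℝ) ≤ B := by exact_mod_cast Nat.sub_le _ _
  nlinarith [abs_nonneg (Real.sin (Real.pi * y))]

lemma sawSum_add {A B C : ℕ} (h1 : A ≤ B) (h2 : B ≤ C) (y : ℝ) :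
    sawSum A B y + sawSum B C y = sawSum A C y :=
  Finset.sum_Ioc_consecutive _ h1 h2

lemma abs_sawSum_le_four (A B : ℕ) (y : ℝ) : |sawSum A B y| ≤ 4 := by
  by_cases hy : Real.sin (Real.pi * y) = 0
  · have := abs_sawSum_le_mul A B y
    rw [hy] at this
    simp at this
    simp [this]
  have hpos : 0 < |Real.sin (Real.pi * y)| := abs_pos.mpr hy
  set s := |Real.sin (Real.pi * y)| with hs
  have hL1 := Nat.floor_le (by positivity : 0 ≤ 1 / s)
  have hL2 := Nat.lt_floor_add_one (1 / s)
  set L := ⌊1 / s⌋₊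
  have small : ∀ A' B', B' ≤ L → |sawSum A' B' y| ≤ 2 := by
    intro A' B' hB
    refine (abs_sawSum_le_mul A' B' y).trans ?_
    have : (B' : ℝ) ≤ 1 / s := le_trans (by exact_mod_cast hB) hL1
    rw [le_div_iff₀ hpos] at this
    rw [← hs]
    linarith
  have large : ∀ A' B', L ≤ A' → |sawSum A' B' y| ≤ 1 := by
    intro A' B' hA
    refine (abs_sawSum_le_div A' B' hy).trans ?_
    rw [← hs]
    have h1 : 1 / s < (A' : ℝ) + 1 := lt_of_lt_of_le hL2 (by exact_mod_cast Nat.succ_le_succ hA)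
    rw [div_lt_iff₀ hpos] at h1
    rw [div_le_one (by positivity)]
    exact h1.le
  rcases le_total B L with hB | hB
  · linarith [small A B hB]
  rcases le_total L A with hA | hA
  · linarith [large A B hA]
  rw [← sawSum_add hA hB]
  refine (abs_add_le _ _).trans ?_
  linarith [small A L le_rfl, large L B le_rfl]

lemma sawSum_zero_eq_sum_range (n : ℕ) (y : ℝ) :
    ∑ i ∈ Finset.range (n + 1), Real.sin (2 * Real.pi * i * y) / i = sawSum 0 n y := by
  rw [Finset.sum_range_succ', sawSum, ← Finset.Icc_add_one_left_eq_Ioc,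
    ← Finset.Ico_add_one_right_eq_Icc, Finset.sum_Ico_eq_sum_range]
  simp [add_comm]

lemma exists_tendsto_sawSum_zero {y : ℝ} (hy : Real.sin (Real.pi * y) ≠ 0) :
    ∃ l, Tendsto (fun n => sawSum 0 n y) atTop (nhds l) := by
  apply cauchySeq_tendsto_of_complete
  have hpos : 0 < |Real.sin (Real.pi * y)| := abs_pos.mpr hy
  refine cauchySeq_of_le_tendsto_0' (fun n : ℕ => 1 / ((n + 1) * |Real.sin (Real.pi * y)|)) ?_ ?_
  · intro n m hnm
    rw [dist_comm, Real.dist_eq, ← sawSum_add (Nat.zero_le n) hnm, add_sub_cancel_left]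
    exact abs_sawSum_le_div n m hy
  · have := (tendsto_one_div_add_atTop_nhds_zero_nat (𝕜 := ℝ)).mul_const
      (1 / |Real.sin (Real.pi * y)|)
    simpa [div_eq_mul_inv, mul_comm] using this

lemma exists_tendsto_sawSum (A : ℕ) {y : ℝ} (hy : Real.sin (Real.pi * y) ≠ 0) :
    ∃ l, Tendsto (fun n => sawSum A n y) atTop (nhds l) := by
  obtain ⟨l, hl⟩ := exists_tendsto_sawSum_zero hy
  refine ⟨l - sawSum 0 A y, (hl.sub_const _).congr' ?_⟩
  filter_upwards [eventually_ge_atTop A] with n hn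
  rw [← sawSum_add (Nat.zero_le A) hn]
  ring

/-- The Fourier series of the sawtooth function. -/
lemma tendsto_sawSum_zero {y : ℝ} (h0 : 0 < y) (h1 : y < 1) :
    Tendsto (fun n => sawSum 0 n y) atTop (nhds (Real.pi / 2 - Real.pi * y)) := by
  have hpi := Real.pi_pos
  have hsin : 0 < Real.sin (Real.pi * y) :=
    Real.sin_pos_of_pos_of_lt_pi (by positivity) (by nlinarith)
  obtain ⟨l, hl⟩ := exists_tendsto_sawSum_zero hsin.ne'
  have hl' : Tendsto (fun n => ∑ i ∈ Finset.range n, Real.sin (2 * Real.pi * i * y) / i) atTop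
      (nhds l) := by
    rw [← tendsto_add_atTop_iff_nat 1]
    simpa only [sawSum_zero_eq_sum_range] using hl
  have habel := Real.tendsto_tsum_powerSeries_nhdsWithin_lt hl'
  set z : ℂ := Complex.exp ((2 * Real.pi * y : ℝ) * Complex.I) with hz
  have hzn : ‖z‖ = 1 := Complex.norm_exp_ofReal_mul_I _
  have hsum : ∀ r ∈ Set.Ioo (0 : ℝ) 1,
      ∑' n : ℕ, Real.sin (2 * Real.pi * n * y) / n * r ^ n = (-Complex.log (1 - r * z)).im := by
    intro r hr
    have hnorm : ‖(r : ℂ) * z‖ < 1 := by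
      rw [norm_mul, hzn, mul_one, Complex.norm_real, Real.norm_of_nonneg hr.1.le]
      exact hr.2
    have := Complex.hasSum_im (Complex.hasSum_taylorSeries_neg_log hnorm)
    rw [← this.tsum_eq]
    congr 1
    ext n
    rw [mul_pow, hz, ← Complex.exp_nat_mul,
      show (n : ℂ) * ((2 * Real.pi * y : ℝ) * Complex.I)
        = (2 * Real.pi * n * y : ℝ) * Complex.I by push_cast; ring,
      ← Complex.ofReal_pow, ← Complex.ofReal_natCast, Complex.div_ofReal_im,
      Complex.im_ofReal_mul, Complex.exp_ofReal_mul_I_im]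
    ring
  have h1z : 1 - z = ((2 * Real.sin (Real.pi * y) : ℝ) : ℂ) *
      (Complex.cos ((Real.pi * y - Real.pi / 2 : ℝ) : ℂ)
        + Complex.sin ((Real.pi * y - Real.pi / 2 : ℝ) : ℂ) * Complex.I) := by
    rw [hz, Complex.exp_mul_I, ← Complex.ofReal_cos, ← Complex.ofReal_sin, ← Complex.ofReal_cos,
      ← Complex.ofReal_sin, Real.cos_sub_pi_div_two, Real.sin_sub_pi_div_two,
      show 2 * Real.pi * y = 2 * (Real.pi * y) by ring, Real.cos_two_mul, Real.sin_two_mul]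
    have h := Real.sin_sq_add_cos_sq (Real.pi * y)
    generalize Real.sin (Real.pi * y) = s at h ⊢
    generalize Real.cos (Real.pi * y) = c at h ⊢
    apply Complex.ext
    · simp [-Complex.ofReal_pow]
      linarith
    · simp [-Complex.ofReal_pow]
  have harg : Complex.arg (1 - z) = Real.pi * y - Real.pi / 2 := by
    rw [h1z]
    exact Complex.arg_mul_cos_add_sin_mul_I (by positivity) ⟨by nlinarith, by nlinarith⟩
  have hslit : 1 - z ∈ Complex.slitPlane := by
    left
    rw [h1z, Complex.re_ofReal_mul, ← Complex.ofReal_cos, ← Complex.ofReal_sin,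
      Real.cos_sub_pi_div_two]
    simp [-Complex.ofReal_sin]
    positivity
  have hlim : Tendsto (fun r : ℝ => (-Complex.log (1 - r * z)).im) (nhdsWithin 1 (Set.Iio 1))
      (nhds (-Complex.log (1 - z)).im) := by
    have hc : ContinuousAt (fun r : ℝ => (-Complex.log (1 - r * z)).im) 1 := by
      apply Complex.continuous_im.continuousAt.comp
      apply ContinuousAt.neg
      apply ContinuousAt.clog
      · fun_prop
      · simpa using hslit
    have := hc.tendsto.mono_left (nhdsWithin_le_nhds (s := Set.Iio 1))
    simpa using this
  have hEq := tendsto_nhds_unique (habel.congr' ?_) hlim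
  · have : (-Complex.log (1 - z)).im = Real.pi / 2 - Real.pi * y := by
      rw [Complex.neg_im, Complex.log_im, harg]
      ring
    rwa [← this, ← hEq]
  · filter_upwards [Ioo_mem_nhdsLT (zero_lt_one' ℝ)] with r hr using hsum r hr

lemma abs_sawSum_zero_sub_le {y : ℝ} (h0 : 0 < y) (h1 : y < 1) (L : ℕ) :
    |sawSum 0 L y - (Real.pi / 2 - Real.pi * y)|
      ≤ 1 / ((L + 1) * |Real.sin (Real.pi * y)|) := by
  have hsin : 0 < Real.sin (Real.pi * y) :=
    Real.sin_pos_of_pos_of_lt_pi (by positivity) (by nlinarith [Real.pi_pos])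
  have ht := ((tendsto_sawSum_zero h0 h1).const_sub (sawSum 0 L y)).abs
  refine le_of_tendsto ht ?_
  filter_upwards [eventually_ge_atTop L] with n hn
  rw [← sawSum_add (Nat.zero_le L) hn, sub_add_cancel_left, abs_neg]
  exact abs_sawSum_le_div L n hsin.ne'

section ContinuedFraction

variable {x : ℝ}

lemma irrational_alphaIter (hx : Irrational x) (k : ℕ) : Irrational (alphaIter k x) := by
  induction k with
  | zero => exact hx
  | succ k ih =>
    rw [alphaIter, one_div, Int.fract]
    exact (irrational_inv_iff.mpr ih).sub_intCast _

lemma alphaIter_pos (hx0 : 0 < x) (hx : Irrational x) (k : ℕ) : 0 < alphaIter k x := by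
  cases k with
  | zero => exact hx0
  | succ k =>
    exact lt_of_le_of_ne (Int.fract_nonneg _) (irrational_alphaIter hx (k + 1)).ne_zero.symm

lemma alphaIter_lt_one (hx1 : x < 1) (k : ℕ) : alphaIter k x < 1 := by
  cases k with
  | zero => exact hx1
  | succ k => exact Int.fract_lt_one _

lemma aIter_succ_pos (hx0 : 0 < x) (hx1 : x < 1) (hx : Irrational x) (k : ℕ) :
    0 < aIter (k + 1) x := by
  have h0 := alphaIter_pos hx0 hx k
  have h1 := alphaIter_lt_one hx1 k
  rw [aIter, Nat.add_sub_cancel, Nat.floor_pos]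
  exact (one_le_div h0).mpr h1.le

lemma alphaIter_mul_succ (hx0 : 0 < x) (hx : Irrational x) (k : ℕ) :
    alphaIter k x * alphaIter (k + 1) x = 1 - aIter (k + 1) x * alphaIter k x := by
  have h0 := alphaIter_pos hx0 hx k
  rw [alphaIter, aIter, Nat.add_sub_cancel, Int.fract,
    natCast_floor_eq_intCast_floor (by positivity)]
  field_simp

/-- The numerators of the convergents. -/
noncomputable def convNum (x : ℝ) : ℕ → ℕ
  | 0 => 0
  | 1 => 1
  | (n + 2) => aIter (n + 2) x * convNum x (n + 1) + convNum x n

/-- The product `α₀ ⋯ α_k`, which is the distance `|v_k x - u_k|`. -/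
noncomputable def convDist (x : ℝ) (k : ℕ) : ℝ := ∏ i ∈ Finset.range (k + 1), alphaIter i x

lemma convDist_succ (k : ℕ) : convDist x (k + 1) = convDist x k * alphaIter (k + 1) x :=
  Finset.prod_range_succ _ _

lemma convDist_pos (hx0 : 0 < x) (hx : Irrational x) (k : ℕ) : 0 < convDist x k :=
  Finset.prod_pos fun i _ => alphaIter_pos hx0 hx i

lemma convDist_succ_le (hx0 : 0 < x) (hx1 : x < 1) (hx : Irrational x) (k : ℕ) :
    convDist x (k + 1) ≤ convDist x k := by
  rw [convDist_succ]
  exact mul_le_of_le_one_right (convDist_pos hx0 hx k).le (alphaIter_lt_one hx1 _).le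

lemma convDen_mul_eq (hx0 : 0 < x) (hx : Irrational x) (k : ℕ) :
    convDen x k * x = convNum x k + (-1) ^ k * convDist x k := by
  induction k using Nat.twoStepInduction with
  | zero => simp [convDen, convNum, convDist, alphaIter]
  | one =>
    have h := alphaIter_mul_succ hx0 hx 0
    simp only [alphaIter, zero_add] at h
    simp [convDen, convNum, convDist, alphaIter, Finset.prod_range_succ]
    simp at h
    linarith
  | more k ih1 ih2 =>
    have h := alphaIter_mul_succ hx0 hx (k + 1)
    rw [convDen, convNum, convDist_succ (k + 1), convDist_succ k]
    rw [convDist_succ k] at ih2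
    push_cast
    rw [mul_assoc (convDist x k), h]
    rw [pow_succ] at ih2 ⊢
    rw [pow_succ]
    linear_combination (aIter (k + 2) x : ℝ) * ih2 + ih1

lemma convDen_convNum_det (k : ℕ) :
    (convDen x (k + 1) : ℤ) * convNum x k - convDen x k * convNum x (k + 1) = (-1) ^ (k + 1) := by
  induction k with
  | zero => simp [convDen, convNum]
  | succ k ih =>
    rw [convDen, convNum, pow_succ, ← ih]
    push_cast
    ring

lemma coprime_convNum_convDen (k : ℕ) : (convNum x k).Coprime (convDen x k) := by
  rw [← Nat.isCoprime_iff_coprime]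
  have h := convDen_convNum_det (x := x) k
  rcases neg_one_pow_eq_or ℤ (k + 1) with h1 | h1
  · exact ⟨convDen x (k + 1), -convNum x (k + 1), by rw [h1] at h; linarith⟩
  · exact ⟨-convDen x (k + 1), convNum x (k + 1), by rw [h1] at h; linarith⟩

lemma convDen_pos (hx0 : 0 < x) (hx1 : x < 1) (hx : Irrational x) (k : ℕ) : 0 < convDen x k := by
  induction k using Nat.twoStepInduction with
  | zero => simp [convDen]
  | one => exact aIter_succ_pos hx0 hx1 hx 0
  | more k ih1 ih2 =>
    rw [convDen]
    positivity

lemma convDen_add_le (hx0 : 0 < x) (hx1 : x < 1) (hx : Irrational x) (k : ℕ) :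
    convDen x (k + 1) + convDen x k ≤ convDen x (k + 2) := by
  rw [convDen]
  gcongr
  exact Nat.le_mul_of_pos_left _ (aIter_succ_pos hx0 hx1 hx _)

lemma convDen_monotone (hx0 : 0 < x) (hx1 : x < 1) (hx : Irrational x) :
    Monotone (convDen x) := by
  apply monotone_nat_of_le_succ
  intro k
  cases k with
  | zero => exact aIter_succ_pos hx0 hx1 hx 0
  | succ k => linarith [convDen_add_le hx0 hx1 hx k]

lemma convDen_lt_succ (hx0 : 0 < x) (hx1 : x < 1) (hx : Irrational x) (k : ℕ) :
    convDen x (k + 1) < convDen x (k + 2) := by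
  linarith [convDen_add_le hx0 hx1 hx k, convDen_pos hx0 hx1 hx k]

lemma convDen_mul_convDist_add (hx0 : 0 < x) (hx : Irrational x) (k : ℕ) :
    convDen x (k + 1) * convDist x k + convDen x k * convDist x (k + 1) = 1 := by
  have h1 := convDen_mul_eq hx0 hx k
  have h2 := convDen_mul_eq hx0 hx (k + 1)
  have h3 : (convDen x (k + 1) : ℝ) * convNum x k - convDen x k * convNum x (k + 1)
      = (-1) ^ (k + 1) := by
    exact_mod_cast convDen_convNum_det (x := x) k
  have h4 : ((-1 : ℝ) ^ k) * (-1) ^ k = 1 := by rw [← mul_pow]; simp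
  rw [pow_succ] at h2 h3
  linear_combination ((-1 : ℝ) ^ k) * convDen x k * h2 - (-1 : ℝ) ^ k * convDen x (k + 1) * h1
    - (-1 : ℝ) ^ k * h3 + (1 - convDen x (k + 1) * convDist x k
    - convDen x k * convDist x (k + 1)) * h4

lemma convDist_le (hx0 : 0 < x) (hx1 : x < 1) (hx : Irrational x) (k : ℕ) :
    convDist x k ≤ 1 / convDen x (k + 1) := by
  have hq : (0 : ℝ) < convDen x (k + 1) := by exact_mod_cast convDen_pos hx0 hx1 hx _
  rw [le_div_iff₀ hq]
  have := convDen_mul_convDist_add hx0 hx k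
  have := mul_nonneg (Nat.cast_nonneg (α := ℝ) (convDen x k)) (convDist_pos hx0 hx (k + 1)).le
  linarith

lemma le_convDist (hx0 : 0 < x) (hx1 : x < 1) (hx : Irrational x) (k : ℕ) :
    1 / (2 * convDen x (k + 1)) ≤ convDist x k := by
  have hq : (0 : ℝ) < convDen x (k + 1) := by exact_mod_cast convDen_pos hx0 hx1 hx _
  rw [div_le_iff₀ (by positivity)]
  have h1 := convDen_mul_convDist_add hx0 hx k
  have h2 : (convDen x k : ℝ) ≤ convDen x (k + 1) := by
    exact_mod_cast convDen_monotone hx0 hx1 hx (Nat.le_succ k)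
  have h3 := mul_le_mul h2 (convDist_succ_le hx0 hx1 hx k) (convDist_pos hx0 hx (k + 1)).le hq.le
  linarith

lemma pow_le_convDen (hx0 : 0 < x) (hx1 : x < 1) (hx : Irrational x) (k : ℕ) :
    (3 / 2 : ℝ) ^ k ≤ 3 / 2 * convDen x k := by
  induction k using Nat.twoStepInduction with
  | zero => norm_num [convDen]
  | one =>
    have : (1 : ℝ) ≤ convDen x 1 := by exact_mod_cast convDen_pos hx0 hx1 hx 1
    linarith
  | more k ih1 ih2 =>
    have : (convDen x (k + 1) : ℝ) + convDen x k ≤ convDen x (k + 2) := by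
      exact_mod_cast convDen_add_le hx0 hx1 hx k
    have h : (0 : ℝ) < (3 / 2) ^ k := by positivity
    rw [pow_succ] at ih2 ⊢
    rw [pow_succ]
    linarith

lemma one_add_log_div_le {q : ℝ} (hq : 0 < q) : (1 + Real.log q) / q ≤ 2 * (√q)⁻¹ := by
  have hs : 0 < √q := Real.sqrt_pos.mpr hq
  have h1 := Real.log_le_sub_one_of_pos hs
  rw [Real.log_sqrt hq.le] at h1
  rw [div_le_iff₀ hq]
  nth_rewrite 3 [← Real.mul_self_sqrt hq.le]
  field_simp
  linarith

lemma summable_one_add_log_convDen_div (hx0 : 0 < x) (hx1 : x < 1) (hx : Irrational x) :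
    Summable fun k => (1 + Real.log (convDen x k)) / (convDen x k : ℝ) := by
  have hr : √(2 / 3 : ℝ) < 1 := by
    rw [Real.sqrt_lt' one_pos]
    norm_num
  refine Summable.of_nonneg_of_le (fun k => ?_) (fun k => ?_)
    ((summable_geometric_of_lt_one (Real.sqrt_nonneg _) hr).mul_left (2 * √(3 / 2)))
  · have : (1 : ℝ) ≤ convDen x k := by exact_mod_cast convDen_pos hx0 hx1 hx k
    have := Real.log_nonneg this
    positivity
  · have hq : (0 : ℝ) < convDen x k := by exact_mod_cast convDen_pos hx0 hx1 hx k
    refine (one_add_log_div_le hq).trans ?_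
    rw [mul_assoc]
    gcongr
    have h := Real.sqrt_le_sqrt (pow_le_convDen hx0 hx1 hx k)
    have hpow : √((3 / 2 : ℝ) ^ k) = √(3 / 2) ^ k := by
      rw [Real.sqrt_eq_iff_mul_self_eq (by positivity) (by positivity), ← mul_pow,
        Real.mul_self_sqrt (by norm_num)]
    rw [Real.sqrt_mul (by norm_num), hpow] at h
    have hs : 0 < √(convDen x k : ℝ) := Real.sqrt_pos.mpr hq
    rw [show (2 / 3 : ℝ) = (3 / 2)⁻¹ by norm_num, Real.sqrt_inv, inv_pow,
      ← div_eq_mul_inv, inv_le_iff_one_le_mul₀ hs, div_mul_eq_mul_div, one_le_div (by positivity)]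
    linarith

end ContinuedFraction

/-- Dirichlet's hyperbola method, folded along the diagonal. -/
lemma sum_card_divisors_mul_eq (f : ℕ → ℝ) (N : ℕ) :
    ∑ n ∈ Finset.Icc 1 N, ((Nat.divisors n).card : ℝ) * f n =
      ∑ n ∈ Finset.Icc 1 N, (if n * n ≤ N then f (n * n) else 0) +
        ∑ m ∈ Finset.Icc 1 N, 2 * ∑ l ∈ Finset.Ioc m (N / m), f (m * l) := by
  have hmain : ∑ n ∈ Finset.Icc 1 N, ((Nat.divisors n).card : ℝ) * f n =
      ∑ a ∈ Finset.Icc 1 N, ∑ b ∈ Finset.Icc 1 N, (if a * b ≤ N then f (a * b) else 0) := by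
    rw [← Finset.sum_product']
    trans ∑ n ∈ Finset.Icc 1 N, ∑ x ∈ Finset.Icc 1 N ×ˢ Finset.Icc 1 N with x.1 * x.2 = n,
      f (x.1 * x.2)
    · refine Finset.sum_congr rfl fun n hn => ?_
      rw [Finset.mem_Icc] at hn
      have h := Nat.divisorsAntidiagonal_eq_prod_filter_of_le (by omega : n ≠ 0) hn.2
      rw [← Finset.Icc_add_one_left_eq_Ioc, zero_add] at h
      rw [← h, Nat.sum_divisorsAntidiagonal (fun a b => f (a * b))]
      have : ∀ d ∈ n.divisors, f (d * (n / d)) = f n := fun d hd => by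
        rw [Nat.mul_div_cancel' (Nat.dvd_of_mem_divisors hd)]
      rw [Finset.sum_congr rfl this, Finset.sum_const, nsmul_eq_mul]
    · simp_rw [Finset.sum_filter]
      rw [Finset.sum_comm]
      refine Finset.sum_congr rfl fun x hx => ?_
      rw [Finset.mem_product, Finset.mem_Icc, Finset.mem_Icc] at hx
      have : 1 ≤ x.1 * x.2 := Nat.mul_pos hx.1.1 hx.2.1
      simp [Finset.sum_ite_eq, this]
  have hupper : ∀ m ∈ Finset.Icc 1 N, ∑ l ∈ Finset.Ioc m (N / m), f (m * l) =
      ∑ b ∈ Finset.Icc 1 N, if m < b ∧ m * b ≤ N then f (m * b) else 0 := by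
    intro m hm
    rw [Finset.mem_Icc] at hm
    rw [← Finset.sum_filter]
    refine Finset.sum_congr ?_ fun _ _ => rfl
    ext b
    simp only [Finset.mem_Ioc, Finset.mem_filter, Finset.mem_Icc]
    rw [Nat.le_div_iff_mul_le (by omega), mul_comm b m]
    constructor
    · rintro ⟨h1, h2⟩
      exact ⟨⟨by omega, le_trans (Nat.le_mul_of_pos_left b (by omega)) h2⟩, h1, h2⟩
    · rintro ⟨-, h⟩
      exact h
  have hsplit : ∀ a b : ℕ, (if a * b ≤ N then f (a * b) else 0) =
      (if a = b then (if a * b ≤ N then f (a * b) else 0) else 0) +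
      ((if a < b ∧ a * b ≤ N then f (a * b) else 0) +
        (if b < a ∧ b * a ≤ N then f (b * a) else 0)) := by
    intro a b
    rw [mul_comm b a]
    rcases lt_trichotomy a b with h | h | h
    · simp [h, h.ne, h.not_gt]
    · simp [h]
    · simp [h, h.ne', h.not_gt]
  rw [hmain, Finset.sum_congr rfl fun a _ => Finset.sum_congr rfl fun b _ => hsplit a b]
  simp only [Finset.sum_add_distrib]
  congr 1
  · refine Finset.sum_congr rfl fun a ha => ?_
    rw [Finset.sum_ite_eq]
    simp [ha]
  · rw [Finset.sum_comm (f := fun a b => if b < a ∧ b * a ≤ N then f (b * a) else 0), ← two_mul,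
      Finset.mul_sum]
    exact Finset.sum_congr rfl fun m hm => by rw [hupper m hm]

/-- The part of `∑_{n ≤ N} d(n) sin (2πnx) / n` coming from factorizations `n = m l`, `l ≠ m`,
whose smaller factor is `m`. -/
noncomputable def divisorTerm (x : ℝ) (m N : ℕ) : ℝ := 2 / m * sawSum m (N / m) (m * x)

lemma sum_divisors_sin_eq (x : ℝ) (N : ℕ) :
    ∑ n ∈ Finset.Icc 1 N, ((Nat.divisors n).card : ℝ) * Real.sin (2 * Real.pi * n * x) / n =
      ∑ n ∈ Finset.Icc 1 N,
        (if n * n ≤ N then Real.sin (2 * Real.pi * (n * n : ℕ) * x) / (n * n : ℕ) else 0) +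
        ∑ m ∈ Finset.Icc 1 N, divisorTerm x m N := by
  simp_rw [mul_div_assoc]
  rw [sum_card_divisors_mul_eq (fun n => Real.sin (2 * Real.pi * n * x) / n) N]
  congr 1
  refine Finset.sum_congr rfl fun m _ => ?_
  rw [divisorTerm, sawSum, Finset.mul_sum, Finset.mul_sum]
  refine Finset.sum_congr rfl fun l _ => ?_
  push_cast
  rw [show 2 * Real.pi * ((m : ℝ) * l) * x = 2 * Real.pi * l * (m * x) by ring, div_mul_div_comm,
    mul_div_assoc']

lemma divisorTerm_eq_zero (x : ℝ) {m N : ℕ} (h : N ≤ m * m) : divisorTerm x m N = 0 := by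
  rw [divisorTerm, sawSum, Finset.Ioc_eq_empty_of_le (Nat.div_le_of_le_mul h)]
  simp

lemma sum_divisorTerm_eq (x : ℝ) {N M : ℕ} (h : N ≤ M * M) :
    ∑ m ∈ Finset.Icc 1 N, divisorTerm x m N = ∑ m ∈ Finset.Ico 1 M, divisorTerm x m N := by
  rcases le_total (N + 1) M with hM | hM
  · refine Finset.sum_subset (fun m hm => ?_) fun m hm hm' => ?_
    · simp at hm ⊢
      omega
    · simp at hm hm'
      apply divisorTerm_eq_zero
      nlinarith [hm' hm.1]
  · refine (Finset.sum_subset (fun m hm => ?_) fun m hm hm' => ?_).symm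
    · simp at hm ⊢
      omega
    · simp at hm hm'
      apply divisorTerm_eq_zero
      nlinarith [hm' hm.1]

lemma exists_tendsto_divisorTerm {x : ℝ} (hx : Irrational x) {m : ℕ} (hm : 0 < m) :
    ∃ l, Tendsto (divisorTerm x m) atTop (nhds l) := by
  have hs : Real.sin (Real.pi * (m * x)) ≠ 0 := by
    intro h
    obtain ⟨n, hn⟩ := Real.sin_eq_zero_iff.mp h
    have h1 : (m : ℝ) * x = n := by
      have := Real.pi_ne_zero
      apply mul_left_cancel₀ this
      linarith
    exact (hx.natCast_mul hm.ne').ne_int n h1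
  obtain ⟨l, hl⟩ := exists_tendsto_sawSum m hs
  have hdiv : Tendsto (fun N : ℕ => N / m) atTop atTop := Nat.tendsto_div_const_atTop hm.ne'
  exact ⟨_, (hl.comp hdiv).const_mul (2 / (m : ℝ))⟩

lemma exists_tendsto_sum_sin_sq (x : ℝ) : ∃ l, Tendsto (fun N : ℕ => ∑ n ∈ Finset.Icc 1 N,
    (if n * n ≤ N then Real.sin (2 * Real.pi * (n * n : ℕ) * x) / (n * n : ℕ) else 0))
    atTop (nhds l) := by
  set f : ℕ → ℝ := fun n => Real.sin (2 * Real.pi * (n * n : ℕ) * x) / (n * n : ℕ)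
  have hf : Summable f := by
    refine Summable.of_norm_bounded (g := fun n : ℕ => 1 / (n : ℝ) ^ 2)
      (Real.summable_one_div_nat_pow.mpr (by norm_num)) fun n => ?_
    rw [Real.norm_eq_abs, abs_div, Nat.abs_cast, pow_two, Nat.cast_mul]
    gcongr
    exact Real.abs_sin_le_one _
  have hsqrt : Tendsto (fun N : ℕ => N.sqrt + 1) atTop atTop := by
    refine tendsto_atTop.mpr fun b => ?_
    filter_upwards [eventually_ge_atTop (b * b)] with N hN
    have := Nat.le_sqrt.mpr hN
    omega
  refine ⟨_, (hf.hasSum.tendsto_sum_nat.comp hsqrt).congr fun N => ?_⟩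
  rw [Function.comp, Finset.sum_range_succ', ← Finset.sum_filter]
  have h0 : f 0 = 0 := by simp [f]
  have hset : {n ∈ Finset.Icc 1 N | n * n ≤ N} = Finset.Ico 1 (N.sqrt + 1) := by
    ext n
    simp only [Finset.mem_filter, Finset.mem_Icc, Finset.mem_Ico, Nat.lt_succ_iff, Nat.le_sqrt]
    constructor
    · rintro ⟨⟨h1, -⟩, h2⟩
      exact ⟨h1, h2⟩
    · rintro ⟨h1, h2⟩
      exact ⟨⟨h1, by nlinarith⟩, h2⟩
  rw [hset, Finset.sum_Ico_eq_sum_range, h0, add_zero, Nat.add_sub_cancel]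
  simp [f, add_comm]

/-- If partial sums `S N` are, up to a convergent quantity, block sums `∑ᵢ E i N` whose blocks are
settled within summable errors of `w i` once `N ≥ Q (i + 1) ^ 2`, then `S` converges exactly when
`∑ w i` does. -/
lemma exists_tendsto_iff_of_blocks {S A : ℕ → ℝ} {Q : ℕ → ℕ} {E : ℕ → ℕ → ℝ} {w e : ℕ → ℝ}
    {C : ℝ} (hQ : StrictMono Q)
    (hS : ∀ N K, N ≤ Q K * Q K → S N = A N + ∑ i ∈ Finset.range K, E i N)
    (hA : ∃ a, Tendsto A atTop (nhds a)) (hE : ∀ i, ∃ l, Tendsto (E i) atTop (nhds l))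
    (he : Summable e) (hbound : ∀ i N, |E i N| ≤ C * (|w i| + e i))
    (hsettled : ∀ i N, Q (i + 1) * Q (i + 1) ≤ N → |E i N - w i| ≤ e i) :
    (∃ s, Tendsto S atTop (nhds s)) ↔
      ∃ s, Tendsto (fun K => ∑ i ∈ Finset.range K, w i) atTop (nhds s) := by
  have he0 : ∀ i, 0 ≤ e i := fun i => (abs_nonneg _).trans (hsettled i _ le_rfl)
  have hQQ : ∀ {i j}, i ≤ j → Q i * Q i ≤ Q j * Q j := fun h =>
    Nat.mul_le_mul (hQ.monotone h) (hQ.monotone h)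
  have hid : ∀ i, i ≤ Q i * Q i := fun i => (hQ.id_le i).trans (Nat.le_mul_self _)
  set G : ℕ → ℕ → ℝ := fun N i => if Q (i + 1) * Q (i + 1) ≤ N then E i N - w i else 0 with hG
  choose l hl using hE
  have hGlim : Tendsto (fun N => ∑' i, G N i) atTop (nhds (∑' i, (l i - w i))) := by
    refine tendsto_tsum_of_dominated_convergence he (fun i => ?_) (Eventually.of_forall ?_)
    · refine ((hl i).sub_const (w i)).congr' ?_
      filter_upwards [eventually_ge_atTop (Q (i + 1) * Q (i + 1))] with N hN
      simp [hG, hN]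
    · intro N i
      rw [Real.norm_eq_abs]
      simp only [hG]
      split_ifs with h
      · exact hsettled i N h
      · simpa using he0 i
  obtain ⟨a, ha⟩ := hA
  have hB := ha.add hGlim
  have hGsum : ∀ N K, Q K * Q K ≤ N → N < Q (K + 1) * Q (K + 1) →
      ∑ i ∈ Finset.range K, E i N = ∑' i, G N i + ∑ i ∈ Finset.range K, w i := by
    intro N K h1 h2
    rw [tsum_eq_sum (s := Finset.range K), ← Finset.sum_add_distrib]
    · refine Finset.sum_congr rfl fun i hi => ?_
      have : Q (i + 1) * Q (i + 1) ≤ N := (hQQ (Finset.mem_range.mp hi)).trans h1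
      simp [hG, this]
    · intro i hi
      have : ¬ Q (i + 1) * Q (i + 1) ≤ N := by
        rw [not_le]
        refine h2.trans_le (hQQ ?_)
        simp at hi
        omega
      simp [hG, this]
  constructor
  · rintro ⟨s, hs⟩
    have hN : Tendsto (fun K => Q K * Q K) atTop atTop := tendsto_atTop_mono hid tendsto_id
    refine ⟨_, ((hs.comp hN).sub (hB.comp hN)).congr fun K => ?_⟩
    simp only [Function.comp]
    have h2 : Q K * Q K < Q (K + 1) * Q (K + 1) :=
      Nat.mul_self_lt_mul_self (hQ (Nat.lt_succ_self K))
    rw [hS _ K le_rfl, hGsum _ K le_rfl h2]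
    ring
  · rintro ⟨s, hs⟩
    set κ : ℕ → ℕ := fun N => Nat.findGreatest (fun i => Q i * Q i ≤ N) N with hκ
    have hκ1 : ∀ N, Q 0 * Q 0 ≤ N → Q (κ N) * Q (κ N) ≤ N := fun N h =>
      Nat.findGreatest_spec (P := fun i => Q i * Q i ≤ N) (Nat.zero_le N) h
    have hκ2 : ∀ N, N < Q (κ N + 1) * Q (κ N + 1) := by
      intro N
      by_contra! h
      have := Nat.le_findGreatest (P := fun i => Q i * Q i ≤ N) ((hid _).trans h) h
      simp only [hκ] at this
      omega
    have hκlim : Tendsto κ atTop atTop := by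
      refine tendsto_atTop.mpr fun b => ?_
      filter_upwards [eventually_ge_atTop (Q b * Q b)] with N hN
      exact Nat.le_findGreatest ((hid b).trans hN) hN
    have hw0 : Tendsto w atTop (nhds 0) := by
      have := (hs.comp (tendsto_add_atTop_nat 1)).sub hs
      simpa [Function.comp_def, Finset.sum_range_succ] using this
    have hzero : Tendsto (fun N => E (κ N) N) atTop (nhds 0) := by
      have h1 : Tendsto (fun i => C * (|w i| + e i)) atTop (nhds 0) := by
        simpa using (hw0.abs.add he.tendsto_atTop_zero).const_mul C
      exact squeeze_zero_norm (fun N => hbound (κ N) N) (h1.comp hκlim)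
    refine ⟨_, ((hB.add (hs.comp hκlim)).add hzero).congr' ?_⟩
    filter_upwards [eventually_ge_atTop (Q 0 * Q 0)] with N hN
    rw [hS N (κ N + 1) (hκ2 N).le, Finset.sum_range_succ, hGsum N _ (hκ1 N hN) (hκ2 N)]
    simp only [Function.comp]
    ring

lemma two_mul_le_sin_pi_mul {a y : ℝ} (ha : 0 ≤ a) (h1 : a ≤ y) (h2 : y ≤ 1 - a) :
    2 * a ≤ Real.sin (Real.pi * y) := by
  have hpi := Real.pi_pos
  rcases le_total y (1 / 2) with h | h
  · have := Real.mul_le_sin (x := Real.pi * y) (by nlinarith) (by nlinarith)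
    rw [← mul_assoc, div_mul_cancel₀ _ hpi.ne'] at this
    linarith
  · have := Real.mul_le_sin (x := Real.pi * (1 - y)) (by nlinarith) (by nlinarith)
    rw [← mul_assoc, div_mul_cancel₀ _ hpi.ne', mul_one_sub Real.pi, Real.sin_pi_sub] at this
    linarith

lemma sawSum_natCast_add (A B c : ℕ) (y : ℝ) : sawSum A B (c + y) = sawSum A B y := by
  refine Finset.sum_congr rfl fun l _ => ?_
  rw [show 2 * Real.pi * l * (c + y) = 2 * Real.pi * l * y + ((l * c : ℕ) : ℝ) * (2 * Real.pi) by
    push_cast; ring, Real.sin_add_nat_mul_two_pi]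

lemma sawSum_neg (A B : ℕ) (y : ℝ) : sawSum A B (-y) = -sawSum A B y := by
  rw [sawSum, sawSum, ← Finset.sum_neg_distrib]
  refine Finset.sum_congr rfl fun l _ => ?_
  rw [mul_neg, Real.sin_neg, neg_div]

lemma sum_Icc_inv_le (n : ℕ) : ∑ j ∈ Finset.Icc 1 n, (j : ℝ)⁻¹ ≤ 1 + Real.log n := by
  have := harmonic_le_one_add_log n
  rwa [harmonic_eq_sum_Icc, Rat.cast_sum, Finset.sum_congr rfl fun i _ => by
    rw [Rat.cast_inv, Rat.cast_natCast]] at this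

lemma log_le_sum_Icc_inv (n : ℕ) :
    Real.log (n + 1) ≤ ∑ j ∈ Finset.Icc 1 n, (j : ℝ)⁻¹ := by
  have := log_add_one_le_harmonic n
  rw [harmonic_eq_sum_Icc, Rat.cast_sum, Finset.sum_congr rfl fun i _ => by
    rw [Rat.cast_inv, Rat.cast_natCast]] at this
  exact_mod_cast this

lemma sum_Icc_inv_sq_le (n : ℕ) : ∑ j ∈ Finset.Icc 1 n, ((j : ℝ) ^ 2)⁻¹ ≤ 2 := by
  have := sum_Ioo_inv_sq_le (α := ℝ) 0 (n + 1)
  rw [show Finset.Icc 1 n = Finset.Ioo 0 (n + 1) by ext; simp; omega]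
  simpa using this

section Block

variable {x σ η : ℝ} {p q q' : ℕ}

/-- The residue `m p mod q` governs the size of the term of index `m`. -/
lemma abs_divisorTerm_le (hq : 0 < q) (hσ : |σ| = 1) (hx : q * x = p + σ * η) (hη0 : 0 < η)
    (hη : η ≤ 1 / q') {m r : ℕ} (hqm : q ≤ m) (hm : m < q') (hr : m * p % q = r) (hr0 : r ≠ 0)
    (N : ℕ) :
    |divisorTerm x m N| ≤ 2 / (q * (m / q : ℕ) ^ 2) * ((r : ℝ)⁻¹ + ((q - r : ℕ) : ℝ)⁻¹) +
      ((if r = 1 then 16 / (q' : ℝ) else 0) + (if r = q - 1 then 16 / (q' : ℝ) else 0)) := by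
  have hm0 : (0 : ℝ) < m := by exact_mod_cast (by omega : 0 < m)
  have hq0 : (0 : ℝ) < q := by exact_mod_cast hq
  have hq'0 : (0 : ℝ) < q' := by exact_mod_cast (by omega : 0 < q')
  have hrq : r < q := hr ▸ Nat.mod_lt _ hq
  have hterm : |divisorTerm x m N| = 2 / m * |sawSum m (N / m) (m * x)| := by
    rw [divisorTerm, abs_mul, abs_of_pos (by positivity : (0 : ℝ) < 2 / m)]
  obtain ⟨c, hc⟩ : ∃ c, m * p = q * c + r := ⟨m * p / q, by rw [← hr, Nat.div_add_mod]⟩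
  have hc' : (m : ℝ) * p = q * c + r := by exact_mod_cast hc
  set y : ℝ := r / q + σ * (m * η / q) with hy
  have hmx : (m : ℝ) * x = c + y := by
    rw [hy]
    field_simp
    linear_combination (m : ℝ) * hx + hc'
  rw [hmx, sawSum_natCast_add] at hterm
  have hshift : |σ * (m * η / q)| ≤ m / q' / q := by
    rw [abs_mul, hσ, one_mul, abs_of_pos (by positivity)]
    gcongr
    rw [div_eq_mul_one_div]
    gcongr
  have hj0 : (0 : ℝ) < (m / q : ℕ) := by exact_mod_cast Nat.div_pos hqm hq
  have hjm : ((m / q : ℕ) : ℝ) * q ≤ m := by exact_mod_cast Nat.div_mul_le_self m q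
  have hr1 : (0 : ℝ) < r := by exact_mod_cast Nat.pos_of_ne_zero hr0
  have hr2 : (0 : ℝ) < (q - r : ℕ) := by exact_mod_cast Nat.sub_pos_of_lt hrq
  have hr3 : ((q - r : ℕ) : ℝ) = q - r := by rw [Nat.cast_sub hrq.le]
  have hF1 : 0 ≤ 2 / (q * ((m / q : ℕ) : ℝ) ^ 2) * ((r : ℝ)⁻¹ + ((q - r : ℕ) : ℝ)⁻¹) := by
    positivity
  by_cases hgood : (m : ℝ) / q' ≤ (min r (q - r) : ℕ) / 2
  · set s : ℕ := min r (q - r) with hs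
    have hs0 : (0 : ℝ) < s := by
      exact_mod_cast (by omega : 0 < s)
    have hsr : (s : ℝ) ≤ r := by exact_mod_cast min_le_left _ _
    have hsr' : (s : ℝ) ≤ q - r := by rw [← hr3]; exact_mod_cast min_le_right _ _
    have hle : |σ * (m * η / q)| ≤ s / 2 / q := hshift.trans (by gcongr)
    rw [abs_le] at hle
    have e1 : (s : ℝ) / 2 / q ≤ r / q - s / 2 / q := by
      rw [div_right_comm, ← sub_nonneg]
      have : (r : ℝ) / q - s / q / 2 - s / q / 2 = (r - s) / q := by ring
      rw [this]
      exact div_nonneg (by linarith) hq0.le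
    have e2 : (r : ℝ) / q + s / 2 / q ≤ 1 - s / 2 / q := by
      rw [← sub_nonneg]
      have : (1 : ℝ) - s / 2 / q - (r / q + s / 2 / q) = (q - r - s) / q := by
        field_simp
        ring
      rw [this]
      exact div_nonneg (by linarith) hq0.le
    have hsin := two_mul_le_sin_pi_mul (a := s / 2 / q) (y := y) (by positivity)
      (by rw [hy]; linarith [hle.1]) (by rw [hy]; linarith [hle.2])
    rw [show 2 * ((s : ℝ) / 2 / q) = s / q by ring] at hsin
    have hsq : (0 : ℝ) < s / q := by positivity
    have hsaw := abs_sawSum_le_div m (N / m) (y := y) (by linarith : 0 < Real.sin _).ne'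
    have hinv : (s : ℝ)⁻¹ ≤ (r : ℝ)⁻¹ + ((q - r : ℕ) : ℝ)⁻¹ := by
      rcases min_choice r (q - r) with h | h
      · rw [hs, h]
        linarith [inv_pos.mpr hr2]
      · rw [hs, h]
        linarith [inv_pos.mpr hr1]
    have hmain : |divisorTerm x m N| ≤ 2 / (q * ((m / q : ℕ) : ℝ) ^ 2) * (s : ℝ)⁻¹ := by
      rw [hterm]
      calc 2 / (m : ℝ) * |sawSum m (N / m) y|
          ≤ 2 / (((m / q : ℕ) : ℝ) * q) * (1 / (((m / q : ℕ) * q) * (s / q))) := by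
            gcongr
            refine hsaw.trans ?_
            have : |Real.sin (Real.pi * y)| = Real.sin (Real.pi * y) := abs_of_pos (by linarith)
            rw [this]
            gcongr
            linarith
        _ = 2 / (q * ((m / q : ℕ) : ℝ) ^ 2) * (s : ℝ)⁻¹ := by
            field_simp
    have h2 := mul_le_mul_of_nonneg_left hinv
      (by positivity : 0 ≤ 2 / (q * ((m / q : ℕ) : ℝ) ^ 2))
    have h3 : 0 ≤ ((if r = 1 then 16 / (q' : ℝ) else 0) +
        (if r = q - 1 then 16 / (q' : ℝ) else 0)) := by
      split_ifs <;> positivity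
    linarith
  · rw [not_le] at hgood
    have hlt : (m : ℝ) / q' < 1 := by
      rw [div_lt_one hq'0]
      exact_mod_cast hm
    have hs1 : min r (q - r) = 1 := by
      have : (min r (q - r) : ℕ) < 2 := by
        by_contra! h
        have : (2 : ℝ) ≤ (min r (q - r) : ℕ) := by exact_mod_cast h
        linarith
      omega
    rw [hs1, Nat.cast_one, lt_div_iff₀ hq'0] at hgood
    have h4 := abs_sawSum_le_four m (N / m) y
    have h16 : |divisorTerm x m N| ≤ 16 / q' := by
      rw [hterm]
      calc 2 / (m : ℝ) * |sawSum m (N / m) y| ≤ 2 / (1 / 2 * q') * 4 := by gcongr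
        _ = 16 / q' := by field_simp; norm_num
    have h5 : 16 / (q' : ℝ) ≤ ((if r = 1 then 16 / (q' : ℝ) else 0) +
        (if r = q - 1 then 16 / (q' : ℝ) else 0)) := by
      have : 0 ≤ 16 / (q' : ℝ) := by positivity
      rcases min_choice r (q - r) with h | h
      · rw [if_pos (by omega : r = 1)]
        split_ifs <;> linarith
      · rw [if_pos (by omega : r = q - 1)]
        split_ifs <;> linarith
    linarith

lemma sum_abs_divisorTerm_not_dvd_le (hq : 2 ≤ q) (hpq : p.Coprime q) (hqq' : q < q')
    (hσ : |σ| = 1) (hx : q * x = p + σ * η) (hη0 : 0 < η) (hη : η ≤ 1 / q') (N : ℕ) :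
    ∑ m ∈ Finset.Ico q q' with ¬ q ∣ m, |divisorTerm x m N| ≤ 40 * (1 + Real.log q) / q := by
  have hq0 : (0 : ℝ) < q := by exact_mod_cast (by omega : 0 < q)
  have hq'0 : (0 : ℝ) < q' := by exact_mod_cast (by omega : 0 < q')
  set F : ℕ → ℕ → ℝ := fun j r => 2 / (q * (j : ℝ) ^ 2) * ((r : ℝ)⁻¹ + ((q - r : ℕ) : ℝ)⁻¹) +
      ((if r = 1 then 16 / (q' : ℝ) else 0) + (if r = q - 1 then 16 / (q' : ℝ) else 0)) with hF
  have hF0 : ∀ j r, 0 ≤ F j r := by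
    intro j r
    simp only [hF]
    split_ifs <;> positivity
  have hinj : Set.InjOn (fun m : ℕ => (m / q, m * p % q))
      ((Finset.Ico q q').filter fun m => ¬ q ∣ m : Finset ℕ) := by
    intro m₁ _ m₂ _ h
    simp only [Prod.mk.injEq] at h
    have h2 : m₁ ≡ m₂ [MOD q] := Nat.ModEq.cancel_right_of_coprime hpq.symm h.2
    rw [← Nat.div_add_mod m₁ q, ← Nat.div_add_mod m₂ q, h.1, h2]
  have hres : ∀ m, ¬ q ∣ m → m * p % q ≠ 0 := by
    intro m hm h
    exact hm (hpq.symm.dvd_of_dvd_mul_right (Nat.dvd_of_mod_eq_zero h))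
  have hstep : ∑ m ∈ Finset.Ico q q' with ¬ q ∣ m, |divisorTerm x m N| ≤
      ∑ j ∈ Finset.Icc 1 (q' / q), ∑ r ∈ Finset.Icc 1 (q - 1), F j r := by
    rw [← Finset.sum_product']
    calc ∑ m ∈ Finset.Ico q q' with ¬ q ∣ m, |divisorTerm x m N|
        ≤ ∑ m ∈ Finset.Ico q q' with ¬ q ∣ m, F (m / q) (m * p % q) := by
          refine Finset.sum_le_sum fun m hm => ?_
          simp only [Finset.mem_filter, Finset.mem_Ico] at hm
          exact abs_divisorTerm_le (by omega) hσ hx hη0 hη hm.1.1 hm.1.2 rfl (hres m hm.2) N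
      _ = ∑ z ∈ ((Finset.Ico q q').filter fun m => ¬ q ∣ m).image
            (fun m : ℕ => (m / q, m * p % q)), F z.1 z.2 := by
          rw [Finset.sum_image hinj]
      _ ≤ _ := by
          refine Finset.sum_le_sum_of_subset_of_nonneg ?_ fun z _ _ => hF0 _ _
          intro z hz
          obtain ⟨m, hm, rfl⟩ := Finset.mem_image.mp hz
          simp only [Finset.mem_filter, Finset.mem_Ico] at hm
          have h1 := hres m hm.2
          have h2 := Nat.mod_lt (m * p) (by omega : q > 0)
          have h3 := Nat.div_pos hm.1.1 (by omega : 0 < q)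
          have h4 := Nat.div_le_div_right (c := q) hm.1.2.le
          simp only [Finset.mem_product, Finset.mem_Icc]
          omega
  refine hstep.trans ?_
  set H := ∑ r ∈ Finset.Icc 1 (q - 1), (r : ℝ)⁻¹ with hH
  have hrefl : ∑ r ∈ Finset.Icc 1 (q - 1), ((q - r : ℕ) : ℝ)⁻¹ = H := by
    refine Finset.sum_nbij' (fun r => q - r) (fun r => q - r) ?_ ?_ ?_ ?_ ?_ <;>
      simp <;> omega
  have hHle : H ≤ 1 + Real.log q := by
    refine (sum_Icc_inv_le (q - 1)).trans ?_
    have : (0 : ℝ) < (q - 1 : ℕ) := by exact_mod_cast (by omega : 0 < q - 1)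
    gcongr
    exact Nat.sub_le _ _
  have hH0 : 0 ≤ H := Finset.sum_nonneg fun _ _ => by positivity
  have hinner : ∀ j, ∑ r ∈ Finset.Icc 1 (q - 1), F j r
      = 4 * H / q * ((j : ℝ) ^ 2)⁻¹ + 32 / q' := by
    intro j
    simp only [hF]
    rw [Finset.sum_add_distrib, ← Finset.mul_sum, Finset.sum_add_distrib, hrefl,
      Finset.sum_add_distrib, Finset.sum_ite_eq', Finset.sum_ite_eq', if_pos (by simp; omega),
      if_pos (by simp; omega)]
    ring
  rw [Finset.sum_congr rfl fun j _ => hinner j, Finset.sum_add_distrib, ← Finset.mul_sum,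
    Finset.sum_const, Nat.card_Icc, nsmul_eq_mul, Nat.add_sub_cancel]
  have h1 := mul_le_mul_of_nonneg_left (sum_Icc_inv_sq_le (q' / q))
    (by positivity : 0 ≤ 4 * H / q)
  have h2 : ((q' / q : ℕ) : ℝ) * (32 / q') ≤ 32 / q := by
    calc ((q' / q : ℕ) : ℝ) * (32 / q') ≤ (q' / q) * (32 / q') := by
          gcongr
          exact Nat.cast_div_le
      _ = 32 / q := by field_simp
  calc _ ≤ 4 * H / q * 2 + 32 / q := add_le_add h1 h2
    _ = (8 * H + 32) / q := by ring
    _ ≤ 40 * (1 + Real.log q) / q := by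
      gcongr
      have : 0 ≤ Real.log q := Real.log_natCast_nonneg q
      linarith

lemma divisorTerm_mul_eq (hσ : σ = 1 ∨ σ = -1) (hx : q * x = p + σ * η) (j N : ℕ) :
    divisorTerm x (j * q) N =
      σ * (2 / (j * q) * sawSum (j * q) (N / (j * q)) (j * η)) := by
  have e : ((j * q : ℕ) : ℝ) * x = (j * p : ℕ) + σ * (j * η) := by
    push_cast
    linear_combination (j : ℝ) * hx
  rw [divisorTerm, e, sawSum_natCast_add]
  rcases hσ with h | h
  · simp [h]
  · simp [h, sawSum_neg]

/-- Away from the diagonal the multiples of `q` contribute little. -/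
lemma abs_sawSum_multiple_le (hq : 2 ≤ q) (hη : η ≤ 1 / q') (hη' : 1 / (2 * q') ≤ η)
    {j : ℕ} (hj : 0 < j) (hjq : j * q < q') (B : ℕ) :
    |sawSum (j * q) B (j * η)| ≤ q' / q / (j : ℝ) ^ 2 := by
  have hq0 : (0 : ℝ) < q := by exact_mod_cast (by omega : 0 < q)
  have hj0 : (0 : ℝ) < j := by exact_mod_cast hj
  have hq'0 : (0 : ℝ) < q' := by exact_mod_cast (by omega : 0 < q')
  have hjq' : (j : ℝ) * q < q' := by exact_mod_cast hjq
  have hq2 : (2 : ℝ) ≤ q := by exact_mod_cast hq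
  have h1 : (j : ℝ) / (2 * q') ≤ j * η := by
    rw [div_eq_mul_one_div]
    gcongr
  have h2 : j * η ≤ (j : ℝ) / q' := by
    rw [div_eq_mul_one_div (j : ℝ)]
    gcongr
  have h3 : (j : ℝ) / q' ≤ 1 / 2 := by
    rw [div_le_iff₀ hq'0]
    nlinarith
  have h4 : (j : ℝ) / (2 * q') = j / q' / 2 := by rw [div_div, mul_comm]
  have hsin := two_mul_le_sin_pi_mul (a := (j : ℝ) / (2 * q')) (by positivity) h1 (by linarith)
  rw [h4, mul_div_cancel₀ _ two_ne_zero] at hsin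
  have hpos : (0 : ℝ) < j / q' := by positivity
  refine (abs_sawSum_le_div (j * q) B (by linarith : 0 < Real.sin _).ne').trans ?_
  rw [abs_of_pos (by linarith)]
  calc 1 / ((((j * q : ℕ) : ℝ) + 1) * Real.sin (Real.pi * (j * η)))
      ≤ 1 / ((j * q) * (j / q')) := by
        gcongr
        push_cast
        linarith
    _ = q' / q / (j : ℝ) ^ 2 := by field_simp

lemma abs_sawSum_multiple_sub_le (hq : 2 ≤ q) (hη : η ≤ 1 / q') (hη' : 1 / (2 * q') ≤ η)
    {j : ℕ} (hj : 0 < j) (hjq : j * q < q') {N : ℕ} (hN : q' * q' ≤ N) :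
    |sawSum (j * q) (N / (j * q)) (j * η) - Real.pi / 2| ≤ 11 * ((j : ℝ) ^ 2 * q / q') := by
  have hq0 : (0 : ℝ) < q := by exact_mod_cast (by omega : 0 < q)
  have hj0 : (0 : ℝ) < j := by exact_mod_cast hj
  have hj1 : (1 : ℝ) ≤ j := by exact_mod_cast hj
  have hq'0 : (0 : ℝ) < q' := by exact_mod_cast (by omega : 0 < q')
  have hjq' : (j : ℝ) * q < q' := by exact_mod_cast hjq
  have hq2 : (2 : ℝ) ≤ q := by exact_mod_cast hq
  have hpi := Real.pi_pos
  have h1 : (j : ℝ) / (2 * q') ≤ j * η := by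
    rw [div_eq_mul_one_div]
    gcongr
  have h2 : j * η ≤ (j : ℝ) / q' := by
    rw [div_eq_mul_one_div (j : ℝ)]
    gcongr
  have h3 : (j : ℝ) / q' ≤ 1 / 2 := by
    rw [div_le_iff₀ hq'0]
    nlinarith
  have h4 : (j : ℝ) / (2 * q') = j / q' / 2 := by rw [div_div, mul_comm]
  have hsin := two_mul_le_sin_pi_mul (a := (j : ℝ) / (2 * q')) (by positivity) h1 (by linarith)
  rw [h4, mul_div_cancel₀ _ two_ne_zero] at hsin
  have hpos : (0 : ℝ) < j / q' := by positivity
  have hθ : 0 < j * η := lt_of_lt_of_le (by positivity) h1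
  have hjq0 : 0 < j * q := Nat.mul_pos hj (by omega)
  have hle : j * q ≤ N / (j * q) := by
    rw [Nat.le_div_iff_mul_le hjq0]
    exact (Nat.mul_le_mul hjq.le hjq.le).trans hN
  have hsplit := sawSum_add (Nat.zero_le _) hle (j * η)
  have hR : (j : ℝ) / q' ≤ (j : ℝ) ^ 2 * q / q' := by
    gcongr
    nlinarith [mul_pos hj0 hq0]
  have hA : |sawSum 0 (N / (j * q)) (j * η) - (Real.pi / 2 - Real.pi * (j * η))|
      ≤ (j : ℝ) ^ 2 * q / q' := by
    refine (abs_sawSum_zero_sub_le hθ (by linarith) _).trans ?_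
    rw [abs_of_pos (by linarith)]
    have hB : (q' : ℝ) * q' / (j * q) ≤ ((N / (j * q) : ℕ) : ℝ) + 1 := by
      have : N < (N / (j * q) + 1) * (j * q) := by
        rw [mul_comm]
        exact Nat.lt_mul_div_succ N hjq0
      rw [div_le_iff₀ (by positivity)]
      exact_mod_cast (hN.trans_lt this).le
    calc 1 / ((((N / (j * q) : ℕ) : ℝ) + 1) * Real.sin (Real.pi * (j * η)))
        ≤ 1 / ((q' * q' / (j * q)) * (j / q')) := by gcongr
      _ = 1 * q / q' := by field_simp
      _ ≤ (j : ℝ) ^ 2 * q / q' := by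
        gcongr
        nlinarith
  have hB : |sawSum 0 (j * q) (j * η)| ≤ 2 * Real.pi * ((j : ℝ) ^ 2 * q / q') := by
    refine (abs_sawSum_le_mul 0 (j * q) _).trans ?_
    rw [abs_of_pos (by linarith)]
    have := Real.sin_le (x := Real.pi * (j * η)) (by positivity)
    calc 2 * ((j * q : ℕ) : ℝ) * Real.sin (Real.pi * (j * η))
        ≤ 2 * (j * q) * (Real.pi * (j / q')) := by
          push_cast
          gcongr
          exact this.trans (by gcongr)
      _ = 2 * Real.pi * ((j : ℝ) ^ 2 * q / q') := by ring
  have hC : Real.pi * (j * η) ≤ Real.pi * ((j : ℝ) ^ 2 * q / q') := by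
    gcongr
    linarith
  have hC0 : 0 < Real.pi * (j * η) := by positivity
  have hR0 : 0 ≤ (j : ℝ) ^ 2 * q / q' := by positivity
  have hpi' : 3 * Real.pi * ((j : ℝ) ^ 2 * q / q') ≤ 10 * ((j : ℝ) ^ 2 * q / q') := by
    gcongr
    linarith [Real.pi_lt_d2]
  rw [abs_le] at hA hB ⊢
  constructor <;> linarith [hA.1, hA.2, hB.1, hB.2]

/-- The multiples of `q` below `q'`. -/
lemma sum_Ico_dvd_eq (hq : 0 < q) (f : ℕ → ℝ) :
    ∑ m ∈ Finset.Ico q q' with q ∣ m, f m = ∑ j ∈ Finset.Icc 1 ((q' - 1) / q), f (j * q) := by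
  symm
  refine Finset.sum_bij' (fun j _ => j * q) (fun m _ => m / q) ?_ ?_ ?_ ?_ ?_
  · intro j hj
    simp only [Finset.mem_Icc, Nat.le_div_iff_mul_le hq] at hj
    have := Nat.mul_le_mul_right q hj.1
    have := Nat.mul_pos hj.1 hq
    simp only [Finset.mem_filter, Finset.mem_Ico]
    exact ⟨by omega, dvd_mul_left q j⟩
  · intro m hm
    simp only [Finset.mem_filter, Finset.mem_Ico] at hm
    rw [Finset.mem_Icc]
    exact ⟨Nat.div_pos hm.1.1 hq, Nat.div_le_div_right (by omega)⟩
  · intro j _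
    exact Nat.mul_div_cancel j hq
  · intro m hm
    exact Nat.div_mul_cancel (Finset.mem_filter.mp hm).2
  · intro j _
    rfl

/-- Contribution of the multiples `j q` of `q` with `j ^ 2 > q' / q`. -/
lemma sum_abs_sawSum_large_le (hq : 2 ≤ q) (hη : η ≤ 1 / q') (hη' : 1 / (2 * q') ≤ η)
    (hqq' : q < q') (N : ℕ) :
    ∑ j ∈ Finset.Ioc (Nat.sqrt (q' / q)) ((q' - 1) / q),
      |2 / (j * q) * sawSum (j * q) (N / (j * q)) (j * η)| ≤ 4 / q := by
  have hq0 : (0 : ℝ) < q := by exact_mod_cast (by omega : 0 < q)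
  have hq'0 : (0 : ℝ) < q' := by exact_mod_cast (by omega : 0 < q')
  set r := Nat.sqrt (q' / q) with hr
  have hr1 : (q' : ℝ) / q ≤ ((r : ℝ) + 1) ^ 2 := by
    have h : q' / q < (r + 1) * (r + 1) := Nat.sqrt_lt.mp (Nat.lt_succ_self r)
    rw [Nat.div_lt_iff_lt_mul (by omega)] at h
    rw [div_le_iff₀ hq0, pow_two]
    exact_mod_cast h.le
  have hterm : ∀ j ∈ Finset.Ioc r ((q' - 1) / q),
      |2 / (j * q) * sawSum (j * q) (N / (j * q)) (j * η)|
        ≤ 2 * (r + 1) / q * ((j : ℝ) ^ 2)⁻¹ := by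
    intro j hj
    simp only [Finset.mem_Ioc, Nat.le_div_iff_mul_le (by omega : 0 < q)] at hj
    have hj0 : (0 : ℝ) < j := by exact_mod_cast (by omega : 0 < j)
    have hrj : (r : ℝ) + 1 ≤ j := by exact_mod_cast hj.1
    have h := abs_sawSum_multiple_le hq hη hη' (by omega : 0 < j) (by omega) (N / (j * q))
    rw [abs_mul, abs_of_pos (by positivity)]
    calc 2 / (j * q) * |sawSum (j * q) (N / (j * q)) (j * η)|
        ≤ 2 / ((r + 1) * q) * ((r + 1) ^ 2 / (j : ℝ) ^ 2) := by
          gcongr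
          exact h.trans (by gcongr)
      _ = 2 * (r + 1) / q * ((j : ℝ) ^ 2)⁻¹ := by field_simp
  refine (Finset.sum_le_sum hterm).trans ?_
  rw [← Finset.mul_sum]
  have hs := sum_Ioo_inv_sq_le (α := ℝ) r ((q' - 1) / q + 1)
  rw [show Finset.Ioo r ((q' - 1) / q + 1) = Finset.Ioc r ((q' - 1) / q) by ext; simp] at hs
  calc _ ≤ 2 * (r + 1) / q * (2 / ((r : ℝ) + 1)) := by gcongr
    _ = 4 / q := by field_simp; norm_num

lemma sqrt_div_le (hq : 2 ≤ q) (hqq' : q < q') : Nat.sqrt (q' / q) ≤ (q' - 1) / q := by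
  rw [Nat.le_div_iff_mul_le (by omega)]
  have h := Nat.sqrt_le (q' / q)
  rw [Nat.le_div_iff_mul_le (by omega)] at h
  generalize Nat.sqrt (q' / q) = r at h
  suffices r * q < q' by omega
  rcases Nat.lt_or_ge r 2 with h2 | h2
  · interval_cases r <;> omega
  · nlinarith [Nat.mul_pos (by omega : 0 < r) (by omega : 0 < q)]

lemma sqrt_div_pos (hq : 2 ≤ q) (hqq' : q < q') : 0 < Nat.sqrt (q' / q) :=
  Nat.sqrt_pos.mpr (Nat.div_pos hqq'.le (by omega))

lemma sq_sqrt_div_le (hq : 2 ≤ q) :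
    (Nat.sqrt (q' / q) : ℝ) ^ 2 ≤ q' / q := by
  have h := Nat.sqrt_le (q' / q)
  have hq0 : (0 : ℝ) < q := by exact_mod_cast (by omega : 0 < q)
  rw [Nat.le_div_iff_mul_le (by omega)] at h
  rw [le_div_iff₀ hq0, pow_two]
  exact_mod_cast h

lemma sum_divisorTerm_dvd_eq (hq : 2 ≤ q) (hqq' : q < q') (hσ : σ = 1 ∨ σ = -1)
    (hx : q * x = p + σ * η) (N : ℕ) :
    ∑ m ∈ Finset.Ico q q' with q ∣ m, divisorTerm x m N =
      σ * (∑ j ∈ Finset.Icc 1 (Nat.sqrt (q' / q)),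
          2 / (j * q) * sawSum (j * q) (N / (j * q)) (j * η) +
        ∑ j ∈ Finset.Ioc (Nat.sqrt (q' / q)) ((q' - 1) / q),
          2 / (j * q) * sawSum (j * q) (N / (j * q)) (j * η)) := by
  rw [sum_Ico_dvd_eq (by omega), Finset.sum_congr rfl fun j _ => divisorTerm_mul_eq hσ hx j N,
    ← Finset.mul_sum]
  congr 1
  have hI (n : ℕ) : Finset.Icc 1 n = Finset.Ioc 0 n := Finset.Icc_add_one_left_eq_Ioc 0 n
  rw [hI, hI, Finset.sum_Ioc_consecutive _ (Nat.zero_le _) (sqrt_div_le hq hqq')]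

lemma abs_sum_small_le (hq : 2 ≤ q) (hqq' : q < q') (N : ℕ) :
    |∑ j ∈ Finset.Icc 1 (Nat.sqrt (q' / q)),
      2 / (j * q) * sawSum (j * q) (N / (j * q)) (j * η)| ≤ 8 * (1 + Real.log q') / q := by
  have hq0 : (0 : ℝ) < q := by exact_mod_cast (by omega : 0 < q)
  have hr0 : (0 : ℝ) < Nat.sqrt (q' / q) := by exact_mod_cast sqrt_div_pos hq hqq'
  have hterm : ∀ j ∈ Finset.Icc 1 (Nat.sqrt (q' / q)),
      |2 / (j * q) * sawSum (j * q) (N / (j * q)) (j * η)| ≤ 8 / q * (j : ℝ)⁻¹ := by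
    intro j hj
    have hj0 : (0 : ℝ) < j := by exact_mod_cast (Finset.mem_Icc.mp hj).1
    have h4 := abs_sawSum_le_four (j * q) (N / (j * q)) (j * η)
    rw [abs_mul, abs_of_pos (by positivity)]
    calc 2 / (j * q) * |sawSum (j * q) (N / (j * q)) (j * η)| ≤ 2 / (j * q) * 4 := by gcongr
      _ = 8 / q * (j : ℝ)⁻¹ := by
        field_simp
        norm_num
  refine (Finset.abs_sum_le_sum_abs _ _).trans ((Finset.sum_le_sum hterm).trans ?_)
  rw [← Finset.mul_sum, mul_div_right_comm]
  have hle : Nat.sqrt (q' / q) ≤ q' := (Nat.sqrt_le_self _).trans (Nat.div_le_self _ _)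
  gcongr
  refine (sum_Icc_inv_le _).trans ?_
  gcongr

lemma abs_sum_small_sub_le (hq : 2 ≤ q) (hqq' : q < q') (hη : η ≤ 1 / q')
    (hη' : 1 / (2 * q') ≤ η) {N : ℕ} (hN : q' * q' ≤ N) :
    |∑ j ∈ Finset.Icc 1 (Nat.sqrt (q' / q)),
        2 / (j * q) * sawSum (j * q) (N / (j * q)) (j * η) - Real.pi / 2 * Real.log q' / q|
      ≤ 26 * (1 + Real.log q) / q := by
  have hq0 : (0 : ℝ) < q := by exact_mod_cast (by omega : 0 < q)
  have hq'0 : (0 : ℝ) < q' := by exact_mod_cast (by omega : 0 < q')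
  have hr0 : (0 : ℝ) < Nat.sqrt (q' / q) := by exact_mod_cast sqrt_div_pos hq hqq'
  have hrJ := sqrt_div_le hq hqq'
  have hr2 := sq_sqrt_div_le (q' := q') hq
  have hr3 : (q' : ℝ) / q ≤ ((Nat.sqrt (q' / q) : ℝ) + 1) ^ 2 := by
    have h : q' / q < (Nat.sqrt (q' / q) + 1) * (Nat.sqrt (q' / q) + 1) :=
      Nat.sqrt_lt.mp (Nat.lt_succ_self _)
    rw [Nat.div_lt_iff_lt_mul (by omega)] at h
    rw [div_le_iff₀ hq0, pow_two]
    exact_mod_cast h.le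
  set r := Nat.sqrt (q' / q)
  set H := ∑ j ∈ Finset.Icc 1 r, (j : ℝ)⁻¹ with hH
  have hpi := Real.pi_pos
  have hterm : ∀ j ∈ Finset.Icc 1 r,
      |2 / (j * q) * sawSum (j * q) (N / (j * q)) (j * η) - Real.pi / q * (j : ℝ)⁻¹|
        ≤ 22 * r / q' := by
    intro j hj
    rw [Finset.mem_Icc] at hj
    have hj0 : (0 : ℝ) < j := by exact_mod_cast hj.1
    have hjr : (j : ℝ) ≤ r := by exact_mod_cast hj.2
    have hjq : j * q < q' := by
      have := hj.2.trans hrJ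
      rw [Nat.le_div_iff_mul_le (by omega)] at this
      omega
    have h := abs_sawSum_multiple_sub_le hq hη hη' hj.1 hjq hN
    have e : 2 / (j * q) * sawSum (j * q) (N / (j * q)) (j * η) - Real.pi / q * (j : ℝ)⁻¹
        = 2 / (j * q) * (sawSum (j * q) (N / (j * q)) (j * η) - Real.pi / 2) := by
      field_simp
    rw [e, abs_mul, abs_of_pos (by positivity)]
    calc _ ≤ 2 / (j * q) * (11 * ((j : ℝ) ^ 2 * q / q')) := by gcongr
      _ = 22 * j / q' := by
        field_simp
        norm_num
      _ ≤ 22 * r / q' := by gcongr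
  have hsum : |∑ j ∈ Finset.Icc 1 r, 2 / (j * q) * sawSum (j * q) (N / (j * q)) (j * η)
      - Real.pi / q * H| ≤ 22 / q := by
    rw [hH, Finset.mul_sum, ← Finset.sum_sub_distrib]
    refine (Finset.abs_sum_le_sum_abs _ _).trans
      ((Finset.sum_le_card_nsmul _ _ _ hterm).trans ?_)
    rw [nsmul_eq_mul, Nat.card_Icc, Nat.add_sub_cancel]
    calc (r : ℝ) * (22 * r / q') = 22 * (r : ℝ) ^ 2 / q' := by ring
      _ ≤ 22 * (q' / q) / q' := by gcongr
      _ = 22 / q := by field_simp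
  have hlog1 : Real.log q' - Real.log q ≤ 2 * H := by
    rw [← Real.log_div hq'0.ne' hq0.ne']
    have h1 := Real.log_le_log (by positivity) hr3
    rw [Real.log_pow] at h1
    have h2 := log_le_sum_Icc_inv r
    push_cast at h1
    linarith
  have hlog2 : 2 * H ≤ 2 + (Real.log q' - Real.log q) := by
    rw [← Real.log_div hq'0.ne' hq0.ne']
    have h1 := Real.log_le_log (by positivity) hr2
    rw [Real.log_pow] at h1
    have h2 := sum_Icc_inv_le r
    push_cast at h1
    linarith
  have hlogq : 0 ≤ Real.log q := Real.log_natCast_nonneg q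
  have hmain : |Real.pi / q * H - Real.pi / 2 * Real.log q' / q| ≤ 4 * (1 + Real.log q) / q := by
    have e : Real.pi / q * H - Real.pi / 2 * Real.log q' / q
        = Real.pi * (H - Real.log q' / 2) / q := by ring
    rw [e, abs_div, abs_mul, abs_of_pos hpi, abs_of_pos hq0]
    gcongr
    · exact Real.pi_lt_four.le
    · rw [abs_le]
      constructor <;> linarith
  have h22 : 22 / (q : ℝ) ≤ 22 * (1 + Real.log q) / q := by
    gcongr
    linarith
  have e26 : 26 * (1 + Real.log q) / q = 22 * (1 + Real.log q) / q + 4 * (1 + Real.log q) / q := by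
    ring
  rw [e26]
  refine (abs_sub_le _ (Real.pi / q * H) _).trans ?_
  linarith

lemma abs_sum_divisorTerm_le (hq : 2 ≤ q) (hpq : p.Coprime q) (hqq' : q < q')
    (hσ : σ = 1 ∨ σ = -1) (hx : q * x = p + σ * η) (hη : η ≤ 1 / q')
    (hη' : 1 / (2 * q') ≤ η) (N : ℕ) :
    |∑ m ∈ Finset.Ico q q', divisorTerm x m N| ≤
      6 * (|Real.pi / 2 * (σ * Real.log q' / q)| + 100 * ((1 + Real.log q) / q)) := by
  have hq0 : (0 : ℝ) < q := by exact_mod_cast (by omega : 0 < q)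
  have hq'0 : (0 : ℝ) < q' := by exact_mod_cast (by omega : 0 < q')
  have hσ1 : |σ| = 1 := by rcases hσ with h | h <;> simp [h]
  have hη0 : 0 < η := lt_of_lt_of_le (by positivity) hη'
  have h1 := (Finset.abs_sum_le_sum_abs _ _).trans
    (sum_abs_divisorTerm_not_dvd_le hq hpq hqq' hσ1 hx hη0 hη N)
  have h2 := abs_sum_small_le (η := η) hq hqq' N
  have h3 := (Finset.abs_sum_le_sum_abs _ _).trans (sum_abs_sawSum_large_le hq hη hη' hqq' N)
  have hlogq : 0 ≤ Real.log q := Real.log_natCast_nonneg q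
  have hlogq' : 0 ≤ Real.log q' := Real.log_natCast_nonneg q'
  rw [← Finset.sum_filter_add_sum_filter_not _ (fun m => q ∣ m),
    sum_divisorTerm_dvd_eq hq hqq' hσ hx]
  refine (abs_add_le _ _).trans ?_
  rw [abs_mul σ, hσ1, one_mul]
  have h4 := abs_add_le (∑ j ∈ Finset.Icc 1 (Nat.sqrt (q' / q)),
      2 / (j * q) * sawSum (j * q) (N / (j * q)) (j * η))
    (∑ j ∈ Finset.Ioc (Nat.sqrt (q' / q)) ((q' - 1) / q),
      2 / (j * q) * sawSum (j * q) (N / (j * q)) (j * η))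
  have e1 : |Real.pi / 2 * (σ * Real.log q' / q)| = Real.pi / 2 * (Real.log q' / q) := by
    rw [mul_div_assoc, abs_mul, abs_mul, hσ1, one_mul, abs_of_pos (by positivity),
      abs_of_nonneg (by positivity)]
  have h5 : 8 * (1 + Real.log q') / q ≤ 8 / q + 6 * (Real.pi / 2 * (Real.log q' / q)) := by
    have : 0 ≤ Real.log q' / q := by positivity
    rw [mul_add, add_div, mul_one, mul_div_assoc]
    nlinarith [Real.pi_gt_three]
  have h6 : 40 * (1 + Real.log q) / q + 12 / q ≤ 600 * ((1 + Real.log q) / q) := by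
    rw [← add_div, ← mul_div_assoc]
    gcongr
    linarith
  have e2 : 12 / (q : ℝ) = 8 / q + 4 / q := by ring
  rw [e1]
  linarith

lemma abs_sum_divisorTerm_sub_le (hq : 2 ≤ q) (hpq : p.Coprime q) (hqq' : q < q')
    (hσ : σ = 1 ∨ σ = -1) (hx : q * x = p + σ * η) (hη : η ≤ 1 / q')
    (hη' : 1 / (2 * q') ≤ η) {N : ℕ} (hN : q' * q' ≤ N) :
    |∑ m ∈ Finset.Ico q q', divisorTerm x m N - Real.pi / 2 * (σ * Real.log q' / q)| ≤
      100 * ((1 + Real.log q) / q) := by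
  have hq0 : (0 : ℝ) < q := by exact_mod_cast (by omega : 0 < q)
  have hq'0 : (0 : ℝ) < q' := by exact_mod_cast (by omega : 0 < q')
  have hσ1 : |σ| = 1 := by rcases hσ with h | h <;> simp [h]
  have hη0 : 0 < η := lt_of_lt_of_le (by positivity) hη'
  have h1 := (Finset.abs_sum_le_sum_abs _ _).trans
    (sum_abs_divisorTerm_not_dvd_le hq hpq hqq' hσ1 hx hη0 hη N)
  have h2 := abs_sum_small_sub_le hq hqq' hη hη' hN
  have h3 := (Finset.abs_sum_le_sum_abs _ _).trans (sum_abs_sawSum_large_le hq hη hη' hqq' N)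
  have hlogq : 0 ≤ Real.log q := Real.log_natCast_nonneg q
  rw [← Finset.sum_filter_add_sum_filter_not _ (fun m => q ∣ m),
    sum_divisorTerm_dvd_eq hq hqq' hσ hx]
  have h4 : 4 / (q : ℝ) ≤ 4 * (1 + Real.log q) / q := by
    gcongr
    linarith
  have hε : 0 ≤ (1 + Real.log q) / q := by positivity
  rw [mul_div_assoc 40] at h1
  rw [mul_div_assoc 26] at h2
  rw [mul_div_assoc 4] at h4
  have key (a b c d : ℝ) (ha : |a - d| ≤ 26 * ((1 + Real.log q) / q))
      (hb : |b| ≤ 4 * ((1 + Real.log q) / q)) (hc : |c| ≤ 40 * ((1 + Real.log q) / q)) :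
      |σ * (a + b) + c - σ * d| ≤ 100 * ((1 + Real.log q) / q) := by
    have e : σ * (a + b) + c - σ * d = σ * (a - d) + σ * b + c := by ring
    rw [e]
    refine (abs_add_three _ _ _).trans ?_
    rw [abs_mul, abs_mul, hσ1]
    linarith
  have e : Real.pi / 2 * (σ * Real.log q' / q) = σ * (Real.pi / 2 * Real.log q' / q) := by ring
  rw [e]
  exact key _ _ _ _ h2 (h3.trans h4) h1

end Block

lemma sum_Ico_convDen_eq {x : ℝ} (hx0 : 0 < x) (hx1 : x < 1) (hx : Irrational x) (f : ℕ → ℝ)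
    (K : ℕ) :
    ∑ m ∈ Finset.Ico 1 (convDen x (K + 2)), f m =
      ∑ m ∈ Finset.Ico 1 (convDen x 2), f m +
        ∑ i ∈ Finset.range K, ∑ m ∈ Finset.Ico (convDen x (i + 2)) (convDen x (i + 3)), f m := by
  induction K with
  | zero => simp
  | succ K ih =>
    rw [Finset.sum_range_succ, ← add_assoc, ← ih, Finset.sum_Ico_consecutive _
      (convDen_pos hx0 hx1 hx _) (convDen_lt_succ hx0 hx1 hx (K + 1)).le]

lemma exists_tendsto_sum_divisorTerm {x : ℝ} (hx : Irrational x) {s : Finset ℕ}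
    (hs : ∀ m ∈ s, 0 < m) :
    ∃ l, Tendsto (fun N => ∑ m ∈ s, divisorTerm x m N) atTop (nhds l) := by
  have h (m : s) := exists_tendsto_divisorTerm hx (hs m m.2)
  choose l hl using h
  refine ⟨∑ m : s, l m, ?_⟩
  simp_rw [← Finset.sum_coe_sort s]
  exact tendsto_finsetSum _ fun m _ => hl m

lemma exists_tendsto_sum_Icc_iff {f g : ℕ → ℝ} {c : ℝ} (hc : c ≠ 0)
    (h : ∀ i, g i = c * f (i + 2)) :
    (∃ s, Tendsto (fun K => ∑ i ∈ Finset.range K, g i) atTop (nhds s)) ↔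
      ∃ s, Tendsto (fun N => ∑ n ∈ Finset.Icc 1 N, f n) atTop (nhds s) := by
  have hsum (K : ℕ) :
      ∑ n ∈ Finset.Icc 1 (K + 1), f n = f 1 + c⁻¹ * ∑ i ∈ Finset.range K, g i := by
    induction K with
    | zero => simp
    | succ K ih =>
      rw [Finset.sum_Icc_succ_top (by omega), ih, Finset.sum_range_succ, h]
      field_simp
      ring
  constructor
  · rintro ⟨s, hs⟩
    refine ⟨f 1 + c⁻¹ * s, (tendsto_add_atTop_iff_nat 1).mp ?_⟩
    simp_rw [hsum]
    exact (hs.const_mul _).const_add _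
  · rintro ⟨s, hs⟩
    refine ⟨c * (s - f 1), ?_⟩
    have := (((tendsto_add_atTop_iff_nat 1).mpr hs).sub_const (f 1)).const_mul c
    simp_rw [hsum, add_sub_cancel_left, mul_inv_cancel_left₀ hc] at this
    exact this

/-- **De la Bretèche–Tenenbaum criterion.** Let `x ∈ (0,1)` be irrational with
continued fraction convergents `u_n/v_n`. Then `∑_{n≥1} d(n) sin(2πnx)/n` converges
(as a limit of partial sums) iff `∑_{n≥1} (-1)^n (log v_{n+1})/v_n` converges;
irrationals for which this holds are called Wilton numbers. -/
theorem stmt_19 (x : ℝ) (hx0 : 0 < x) (hx1 : x < 1) (hx : Irrational x) :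
    (∃ S : ℝ, Tendsto (fun N : ℕ => ∑ n ∈ Finset.Icc 1 N,
        ((Nat.divisors n).card : ℝ) * Real.sin (2 * Real.pi * n * x) / n)
      atTop (nhds S)) ↔
    (∃ S : ℝ, Tendsto (fun N : ℕ => ∑ n ∈ Finset.Icc 1 N,
        (-1 : ℝ) ^ n * Real.log (convDen x (n + 1)) / convDen x n)
      atTop (nhds S)) := by
  have hlt (i : ℕ) : convDen x (i + 2) < convDen x (i + 3) := convDen_lt_succ hx0 hx1 hx (i + 1)
  have htwo (i : ℕ) : 2 ≤ convDen x (i + 2) :=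
    Nat.succ_le_of_lt (lt_of_le_of_lt (convDen_pos hx0 hx1 hx (i + 1))
      (convDen_lt_succ hx0 hx1 hx i))
  rw [← exists_tendsto_sum_Icc_iff (c := Real.pi / 2)
    (f := fun n => (-1 : ℝ) ^ n * Real.log (convDen x (n + 1)) / convDen x n)
    (by positivity) fun _ => rfl]
  refine exists_tendsto_iff_of_blocks (Q := fun i => convDen x (i + 2))
    (A := fun N => ∑ n ∈ Finset.Icc 1 N,
        (if n * n ≤ N then Real.sin (2 * Real.pi * (n * n : ℕ) * x) / (n * n : ℕ) else 0) +
      ∑ m ∈ Finset.Ico 1 (convDen x 2), divisorTerm x m N)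
    (E := fun i N => ∑ m ∈ Finset.Ico (convDen x (i + 2)) (convDen x (i + 3)), divisorTerm x m N)
    (e := fun i => 100 * ((1 + Real.log (convDen x (i + 2))) / convDen x (i + 2))) (C := 6)
    (strictMono_nat_of_lt_succ hlt) ?_ ?_ ?_ ?_ ?_ ?_
  · intro N K hN
    rw [sum_divisors_sin_eq, sum_divisorTerm_eq x hN, sum_Ico_convDen_eq hx0 hx1 hx, add_assoc]
  · obtain ⟨a, ha⟩ := exists_tendsto_sum_sin_sq x
    obtain ⟨b, hb⟩ := exists_tendsto_sum_divisorTerm (s := Finset.Ico 1 (convDen x 2)) hx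
      fun m hm => (Finset.mem_Ico.mp hm).1
    exact ⟨a + b, ha.add hb⟩
  · exact fun i => exists_tendsto_sum_divisorTerm hx fun m hm =>
      (convDen_pos hx0 hx1 hx _).trans_le (Finset.mem_Ico.mp hm).1
  · exact ((summable_nat_add_iff 2).mpr (summable_one_add_log_convDen_div hx0 hx1 hx)).mul_left _
  · exact fun i N => abs_sum_divisorTerm_le (htwo i) (coprime_convNum_convDen _) (hlt i)
      (neg_one_pow_eq_or ℝ _) (convDen_mul_eq hx0 hx _) (convDist_le hx0 hx1 hx _)
      (le_convDist hx0 hx1 hx _) N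
  · exact fun i N hN => abs_sum_divisorTerm_sub_le (htwo i) (coprime_convNum_convDen _) (hlt i)
      (neg_one_pow_eq_or ℝ _) (convDen_mul_eq hx0 hx _) (convDist_le hx0 hx1 hx _)
      (le_convDist hx0 hx1 hx _) hN
end
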